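/- Let d ≥ 1, 0 < s < 1/2, and let f : [−1,1] → ℝ be C^{1,α} with α > 1−2s. Let u be a stable solution of (−Δ)^s u = f(u) in ℝ^d with |u| ≤ 1. Then there is a constant C₁ = C₁(d,s), independent of f, such that for every x₀ ∈ ℝ^d and every R ≥ 1: ∫_{B_R(x₀)} |∇u(x)| dx ≤ C₁ · R^{d−1}. -/

import Mathlib

open MeasureTheory Metric Set
open scoped ENNReal NNReal

/-- The fractional `s`-energy `J^s(u,Ω)` of `u : ℝ^d → ℝ` on an open set `Ω`:
`J^s(u,Ω) = ∬_{(ℝ^d×ℝ^d)∖(Ωᶜ×Ωᶜ)} |u(x)−u(y)|²/|x−y|^{d+2s} dy dx`, valued in `[0,∞]`. -/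
noncomputable def Js (d : ℕ) (s : ℝ) (u : EuclideanSpace ℝ (Fin d) → ℝ)
    (Ω : Set (EuclideanSpace ℝ (Fin d))) : ℝ≥0∞ :=
  ∫⁻ p : EuclideanSpace ℝ (Fin d) × EuclideanSpace ℝ (Fin d) in (Ωᶜ ×ˢ Ωᶜ)ᶜ,
    ENNReal.ofReal ((u p.1 - u p.2)^2 / ‖p.1 - p.2‖ ^ ((d : ℝ) + 2*s))

/-- The normalizing constant `C(d,s) = 2^{2s} Γ(d/2+s) / (π^{d/2} |Γ(−s)|)` of the fractional
Laplacian, which normalizes its Fourier symbol to `|ξ|^{2s}`. -/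
noncomputable def fracC (d : ℕ) (s : ℝ) : ℝ :=
  2 ^ (2*s) * Real.Gamma ((d : ℝ)/2 + s) / (Real.pi ^ ((d : ℝ)/2) * |Real.Gamma (-s)|)

/-- `f : [−1,1] → ℝ` is `C^{1,α}`: it has derivative `f'` on `[−1,1]` and `f'` is
`α`-Hölder continuous on `[−1,1]`. -/
def IsC1Alpha (f f' : ℝ → ℝ) (α : ℝ) : Prop :=
  (∀ x ∈ Set.Icc (-1 : ℝ) 1, HasDerivAt f (f' x) x) ∧
  ∃ Cα : ℝ, 0 ≤ Cα ∧ ∀ x ∈ Set.Icc (-1 : ℝ) 1, ∀ y ∈ Set.Icc (-1 : ℝ) 1,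
    |f' x - f' y| ≤ Cα * |x - y| ^ α

/-- `u ∈ C²(ℝ^d)` with `|u| ≤ 1` is a stable solution of `(−Δ)^s u = f(u)` in `ℝ^d`:
the equation `(C(d,s)/2)∫ (2u(x)−u(x+y)−u(x−y))/|y|^{d+2s} dy = f(u(x))` holds pointwise and
for every `η ∈ C_c^∞(ℝ^d)` one has
`(C(d,s)/2) ∬ |η(x)−η(y)|²/|x−y|^{d+2s} dx dy ≥ ∫ f'(u(x)) η(x)² dx`. -/
def IsStableSolution (d : ℕ) (s : ℝ) (f f' : ℝ → ℝ)
    (u : EuclideanSpace ℝ (Fin d) → ℝ) : Prop :=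
  ContDiff ℝ 2 u ∧ (∀ x, |u x| ≤ 1) ∧
  (∀ x : EuclideanSpace ℝ (Fin d),
    fracC d s / 2 * ∫ y : EuclideanSpace ℝ (Fin d),
      (2 * u x - u (x + y) - u (x - y)) / ‖y‖ ^ ((d : ℝ) + 2*s) = f (u x)) ∧
  (∀ η : EuclideanSpace ℝ (Fin d) → ℝ, ContDiff ℝ (⊤ : ℕ∞) η → HasCompactSupport η →
    ∫ x : EuclideanSpace ℝ (Fin d), f' (u x) * (η x)^2 ≤
      fracC d s / 2 * ∫ x : EuclideanSpace ℝ (Fin d), ∫ y : EuclideanSpace ℝ (Fin d),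
        (η x - η y)^2 / ‖x - y‖ ^ ((d : ℝ) + 2*s))

open MeasureTheory Metric Set
open scoped ENNReal NNReal

/-- The truncated kernel. -/
noncomputable def kk {E : Type*} [NormedAddCommGroup E] (q : ℝ) (z : E) : ℝ :=
  min 1 ‖z‖ * (‖z‖ ^ q)⁻¹

theorem kk_integrable (d : ℕ) (hd : 1 ≤ d) (s : ℝ) (hs0 : 0 < s) (hs1 : s < 1/2) :
    Integrable (fun z : EuclideanSpace ℝ (Fin d) => kk ((d:ℝ) + 2*s) z) := by
  have : Nonempty (Fin d) := ⟨⟨0, hd⟩⟩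
  have : Nontrivial (EuclideanSpace ℝ (Fin d)) := by
    apply Module.nontrivial_of_finrank_pos (R := ℝ)
    simp; omega
  have := (integrable_fun_norm_addHaar (volume : Measure (EuclideanSpace ℝ (Fin d)))
    (f := fun r : ℝ => min 1 r * (r ^ ((d:ℝ) + 2*s))⁻¹)).2 ?_
  · exact this
  have hu : Ioi (0:ℝ) = Ioo 0 1 ∪ Ici 1 := by
    ext x; simp only [mem_Ioi, mem_union, mem_Ioo, mem_Ici]; grind
  rw [hu]
  have hpow : ∀ y : ℝ, 0 < y → y ^ (d - 1) * (y ^ ((d:ℝ) + 2*s))⁻¹ = y ^ (-1 - 2*s) := by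
    intro y hy
    rw [← Real.rpow_natCast, ← Real.rpow_neg hy.le, ← Real.rpow_add hy]
    congr 1
    rw [Nat.cast_sub hd]; push_cast; ring
  simp only [finrank_euclideanSpace, Fintype.card_fin, smul_eq_mul]
  refine IntegrableOn.union ?_ ?_
  · have h1 : IntegrableOn (fun y : ℝ => y ^ (-2*s)) (Ioo 0 1) := by
      rw [intervalIntegral.integrableOn_Ioo_rpow_iff one_pos]; linarith
    refine h1.congr_fun ?_ measurableSet_Ioo
    intro y hy
    simp only
    rw [min_eq_right hy.2.le, mul_left_comm, hpow y hy.1]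
    conv_rhs => rw [← Real.rpow_one y]
    rw [← Real.rpow_mul hy.1.le, ← Real.rpow_add hy.1]; congr 1; ring
  · rw [integrableOn_Ici_iff_integrableOn_Ioi]
    have h1 : IntegrableOn (fun y : ℝ => y ^ (-1-2*s)) (Ioi 1) :=
      integrableOn_Ioi_rpow_of_lt (by linarith) one_pos
    refine h1.congr_fun ?_ measurableSet_Ioi
    intro y hy
    have hy : 1 < y := hy
    simp only
    rw [min_eq_left hy.le, one_mul, hpow y (by linarith)]

open MeasureTheory Metric Set
open scoped ENNReal NNReal

section PTwo
set_option linter.unusedSectionVars false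
variable {E : Type*} [NormedAddCommGroup E] [InnerProductSpace ℝ E] [FiniteDimensional ℝ E]
  [MeasurableSpace E] [BorelSpace E]

/-- The kernel. -/
noncomputable def KK {E : Type*} [NormedAddCommGroup E] (q : ℝ) (z : E) : ℝ := (‖z‖ ^ q)⁻¹

theorem KK_nonneg (q : ℝ) (z : E) : 0 ≤ KK q z := by unfold KK; positivity

theorem kk_nonneg (q : ℝ) (z : E) : 0 ≤ kk q z := by unfold kk; positivity

theorem KK_neg (q : ℝ) (z : E) : KK q (-z) = KK q z := by unfold KK; simp

theorem KK_meas (q : ℝ) : Measurable (KK (E := E) q) := by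
  unfold KK; fun_prop

theorem KK_mul_le (q : ℝ) (z : E) {t a b : ℝ} (ha : 0 ≤ a) (hb : 0 ≤ b) (h1 : t ≤ a)
    (h2 : t ≤ b * ‖z‖) : KK q z * t ≤ (a + b) * kk q z := by
  have hk := KK_nonneg q z
  have hz := norm_nonneg z
  unfold kk
  change _ ≤ (a + b) * (min 1 ‖z‖ * KK q z)
  rw [mul_comm (KK q z), ← mul_assoc]
  refine mul_le_mul_of_nonneg_right ?_ hk
  rcases min_choice 1 ‖z‖ with h | h <;> rw [h]
  · linarith
  · nlinarith

theorem dom_integrable {q : ℝ} (hk : Integrable (kk (E := E) q)) {b : E → ℝ} (hb : Integrable b)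
    {F : E × E → ℝ} (hF : AEStronglyMeasurable F (volume.prod volume))
    (h : ∀ x z, |F (x, z)| ≤ b x * kk q z) : Integrable F (volume.prod volume) := by
  refine (hb.mul_prod hk).mono' hF ?_
  filter_upwards with p
  exact h p.1 p.2

/-- The form density. -/
noncomputable def FF (q : ℝ) (η : E → ℝ) (p : E × E) : ℝ :=
  KK q p.2 * (η p.1 * (η p.1 - η (p.1 + p.2)))

theorem FF_meas (q : ℝ) {η : E → ℝ} (hc : Continuous η) : Measurable (FF q η) := by
  unfold FF
  have := KK_meas (E := E) q
  have h2 := hc.measurable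
  fun_prop

theorem FF_bound (q : ℝ) {η : E → ℝ} {M L r : ℝ}
    (hM : ∀ x, |η x| ≤ M) (hL : ∀ x y, |η x - η y| ≤ L * ‖x - y‖)
    (hr : ∀ x, r < ‖x‖ → η x = 0) (hM0 : 0 ≤ M) (hL0 : 0 ≤ L) (x z : E) :
    |FF q η (x, z)| ≤ (closedBall (0:E) r).indicator (fun _ => M * (2 * M + L)) x * kk q z := by
  by_cases hx : x ∈ closedBall (0:E) r
  · rw [indicator_of_mem hx]
    unfold FF
    simp only
    rw [abs_mul, abs_of_nonneg (KK_nonneg q z), abs_mul]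
    have h1 : |η x - η (x+z)| ≤ 2 * M := by
      have := abs_sub (η x) (η (x+z)); have := hM x; have := hM (x+z); linarith
    have h2 : |η x - η (x+z)| ≤ L * ‖z‖ := by
      have := hL x (x+z); simpa using this
    have h3 := KK_mul_le q z (by positivity) hL0 h1 h2
    have h4 := KK_nonneg q z
    calc KK q z * (|η x| * |η x - η (x+z)|) = |η x| * (KK q z * |η x - η (x+z)|) := by ring
      _ ≤ M * ((2 * M + L) * kk q z) := by
          have := hM x
          gcongr
      _ = _ := by ring
  · rw [indicator_of_notMem hx]
    have : η x = 0 := hr x (by simpa using hx)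
    simp [FF, this]

theorem ind_integrable (r C : ℝ) :
    Integrable ((closedBall (0:E) r).indicator (fun _ => C)) := by
  rw [integrable_indicator_iff measurableSet_closedBall]
  exact integrableOn_const (measure_closedBall_lt_top.ne)

theorem FF_integrable {q : ℝ} (hk : Integrable (kk (E := E) q)) {η : E → ℝ} {M L r : ℝ}
    (hc : Continuous η)
    (hM : ∀ x, |η x| ≤ M) (hL : ∀ x y, |η x - η y| ≤ L * ‖x - y‖)
    (hr : ∀ x, r < ‖x‖ → η x = 0) (hM0 : 0 ≤ M) (hL0 : 0 ≤ L) :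
    Integrable (FF q η) (volume.prod volume) :=
  dom_integrable hk (ind_integrable r _) (FF_meas q hc).aestronglyMeasurable
    (FF_bound q hM hL hr hM0 hL0)

theorem form_eq {q : ℝ} {η : E → ℝ} (hF : Integrable (FF q η) (volume.prod volume)) :
    ∫ x, ∫ y, (η x - η y)^2 / ‖x - y‖ ^ q = 2 * ∫ p, FF q η p ∂(volume.prod volume) := by
  set G : E × E → ℝ := fun p => KK q (p.1 - p.2) * (η p.1 * (η p.1 - η p.2)) with hG
  have hmp := measurePreserving_prod_add (volume : Measure E) (volume : Measure E)
  have hemb : MeasurableEmbedding (fun z : E × E => (z.1, z.1 + z.2)) :=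
    (MeasurableEquiv.shearAddRight E).measurableEmbedding
  have hcomp : G ∘ (fun z : E × E => (z.1, z.1 + z.2)) = FF q η := by
    ext p
    simp only [hG, FF, Function.comp]
    rw [show p.1 - (p.1 + p.2) = -p.2 by abel, KK_neg]
  have hGi : Integrable G (volume.prod volume) := by
    rw [← hmp.integrable_comp_emb hemb, hcomp]; exact hF
  have hGint : ∫ p, FF q η p ∂(volume.prod volume) = ∫ p, G p ∂(volume.prod volume) := by
    have := hmp.integral_comp hemb G
    rw [← this, ← hcomp]; rfl
  have hsw : ∫ p : E × E, G p.swap ∂(volume.prod volume) = ∫ p, G p ∂(volume.prod volume) :=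
    integral_prod_swap G
  have hsum : ∀ p : E × E, (η p.1 - η p.2)^2 / ‖p.1 - p.2‖ ^ q = G p + G p.swap := by
    intro p
    simp only [hG, Prod.fst_swap, Prod.snd_swap]
    rw [← neg_sub p.1 p.2, KK_neg]
    unfold KK; ring
  have hI : Integrable (fun p : E × E => (η p.1 - η p.2)^2 / ‖p.1 - p.2‖ ^ q)
      (volume.prod volume) := by
    simp_rw [hsum]; exact hGi.add hGi.swap
  rw [hGint, ← integral_prod (fun p : E × E => (η p.1 - η p.2)^2 / ‖p.1 - p.2‖ ^ q) hI]
  simp_rw [hsum]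
  have hadd : ∫ p, (G p + G p.swap) ∂(volume.prod volume) = ∫ p, G p ∂(volume.prod volume) +
      ∫ p, G p.swap ∂(volume.prod volume) := integral_add hGi hGi.swap
  rw [hadd, hsw]; ring

end PTwo

open MeasureTheory Metric Set
open scoped ENNReal NNReal

section PThree
set_option linter.unusedSectionVars false
variable {E : Type*} [NormedAddCommGroup E] [InnerProductSpace ℝ E] [FiniteDimensional ℝ E]
  [MeasurableSpace E] [BorelSpace E]

theorem exists_mollify {η : E → ℝ} {M L r : ℝ}
    (hc : Continuous η)
    (hM : ∀ x, |η x| ≤ M) (hL : ∀ x y, |η x - η y| ≤ L * ‖x - y‖)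
    (hr : ∀ x, r < ‖x‖ → η x = 0) (hL0 : 0 ≤ L) :
    ∃ ζ : ℕ → E → ℝ, (∀ n, ContDiff ℝ (⊤ : ℕ∞) (ζ n)) ∧ (∀ n x, |ζ n x| ≤ M + L) ∧
      (∀ n x y, |ζ n x - ζ n y| ≤ L * ‖x - y‖) ∧ (∀ n x, r + 1 < ‖x‖ → ζ n x = 0) ∧
      (∀ x, Filter.Tendsto (fun n => ζ n x) Filter.atTop (nhds (η x))) := by
  have hpos : ∀ n : ℕ, (0:ℝ) < 1 / ((n:ℝ) + 1) := fun n => by positivity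
  let b : ℕ → ContDiffBump (0:E) := fun n =>
    ⟨1 / ((n:ℝ)+1) / 2, 1 / ((n:ℝ)+1), by have := hpos n; linarith, by have := hpos n; linarith⟩
  have hb : ∀ n, (b n).rOut = 1 / ((n:ℝ)+1) := fun n => rfl
  have hb1 : ∀ n, (b n).rOut ≤ 1 := fun n => by
    rw [hb, div_le_one (by positivity)]; have : (0:ℝ) ≤ n := by positivity
    linarith
  let ζ : ℕ → E → ℝ := fun n =>
    MeasureTheory.convolution ((b n).normed volume) η (ContinuousLinearMap.lsmul ℝ ℝ) volume
  have hdist : ∀ n x, |ζ n x - η x| ≤ L * (1 / ((n:ℝ)+1)) := by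
    intro n x
    have := (b n).dist_normed_convolution_le (μ := volume) (g := η) (x₀ := x)
      (ε := L * (1 / ((n:ℝ)+1))) hc.aestronglyMeasurable ?_
    · rwa [Real.dist_eq] at this
    · intro y hy
      rw [Real.dist_eq]
      refine (hL y x).trans ?_
      rw [mem_ball, dist_eq_norm, hb] at hy
      gcongr
  refine ⟨ζ, ?_, ?_, ?_, ?_, ?_⟩
  · intro n
    exact (b n).hasCompactSupport_normed.contDiff_convolution_left _ (b n).contDiff_normed
      (hc.locallyIntegrable)
  · intro n x
    have h1 := hdist n x
    have h2 := hM x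
    have h3 : L * (1 / ((n:ℝ)+1)) ≤ L * 1 := by
      have := hb1 n; rw [hb] at this; gcongr
    have := abs_sub_abs_le_abs_sub (ζ n x) (η x)
    linarith
  · intro n x y
    have hint : ∀ x, Integrable (fun t => (b n).normed volume t * η (x - t)) := by
      intro x
      apply Continuous.integrable_of_hasCompactSupport
      · exact ((b n).continuous_normed).mul (hc.comp (continuous_const.sub continuous_id))
      · exact ((b n).hasCompactSupport_normed (μ := volume)).mul_right
    have e : ζ n x - ζ n y = ∫ t, (b n).normed volume t * (η (x - t) - η (y - t)) := by
      simp only [mul_sub]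
      rw [integral_sub (hint x) (hint y)]
      rfl
    rw [e]
    have : ∀ t, ‖(b n).normed volume t * (η (x - t) - η (y - t))‖ ≤
        (b n).normed volume t * (L * ‖x - y‖) := by
      intro t
      rw [Real.norm_eq_abs, abs_mul, abs_of_nonneg ((b n).nonneg_normed t)]
      refine mul_le_mul_of_nonneg_left ?_ ((b n).nonneg_normed t)
      have := hL (x - t) (y - t)
      simpa using this
    have h2 := norm_integral_le_of_norm_le (((b n).integrable_normed).mul_const (L * ‖x - y‖))
      (Filter.Eventually.of_forall this)
    rw [integral_mul_const, (b n).integral_normed, one_mul, Real.norm_eq_abs] at h2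
    exact h2
  · intro n x hx
    have h0 : ∀ y ∈ ball x (b n).rOut, η y = 0 := by
      intro y hy
      apply hr
      rw [mem_ball, dist_comm, dist_eq_norm] at hy
      have := hb1 n
      have := norm_sub_norm_le x y
      linarith
    have hx0 : η x = 0 := h0 x (mem_ball_self (b n).rOut_pos)
    have := (b n).normed_convolution_eq_right (μ := volume) (g := η) (x₀ := x)
      (fun y hy => by rw [h0 y hy, hx0])
    rw [← hx0]; exact this
  · intro x
    rw [tendsto_iff_dist_tendsto_zero]
    refine squeeze_zero (fun _ => dist_nonneg) (fun n => hdist n x) ?_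
    have := tendsto_one_div_add_atTop_nhds_zero_nat (𝕜 := ℝ)
    simpa using this.const_mul L

theorem stab_ext {q : ℝ} (hk : Integrable (kk (E := E) q)) {g0 : E → ℝ} (hg0 : Continuous g0)
    {c : ℝ}
    (hst : ∀ η : E → ℝ, ContDiff ℝ (⊤ : ℕ∞) η → HasCompactSupport η →
      ∫ x, g0 x * (η x)^2 ≤ c / 2 * ∫ x, ∫ y, (η x - η y)^2 / ‖x - y‖ ^ q)
    {η : E → ℝ} {M L r : ℝ}
    (hc : Continuous η)
    (hM : ∀ x, |η x| ≤ M) (hL : ∀ x y, |η x - η y| ≤ L * ‖x - y‖)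
    (hr : ∀ x, r < ‖x‖ → η x = 0) (hM0 : 0 ≤ M) (hL0 : 0 ≤ L) :
    ∫ x, g0 x * (η x)^2 ≤ c * ∫ p, FF q η p ∂(volume.prod volume) := by
  obtain ⟨ζ, h1, h2, h3, h4, h5⟩ := exists_mollify hc hM hL hr hL0
  have hle : ∀ n, ∫ x, g0 x * (ζ n x)^2 ≤ c * ∫ p, FF q (ζ n) p ∂(volume.prod volume) := by
    intro n
    have hcs : HasCompactSupport (ζ n) := by
      apply HasCompactSupport.intro (isCompact_closedBall (0:E) (r+1))
      intro x hx
      exact h4 n x (by simpa using hx)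
    have := hst (ζ n) (h1 n) hcs
    rw [form_eq (FF_integrable hk (h1 n).continuous (h2 n) (h3 n) (h4 n) (by positivity) hL0)]
      at this
    linarith
  refine le_of_tendsto_of_tendsto' (b := Filter.atTop) ?_ ?_ hle
  · refine tendsto_integral_of_dominated_convergence
      (fun x => (closedBall (0:E) (r+1)).indicator (fun x => |g0 x| * (M+L)^2) x) ?_ ?_ ?_ ?_
    · intro n
      exact (hg0.mul ((h1 n).continuous.pow 2)).aestronglyMeasurable
    · rw [integrable_indicator_iff measurableSet_closedBall]
      exact (Continuous.continuousOn (by fun_prop)).integrableOn_compact (isCompact_closedBall _ _)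
    · intro n
      filter_upwards with x
      by_cases hx : x ∈ closedBall (0:E) (r+1)
      · rw [indicator_of_mem hx, Real.norm_eq_abs, abs_mul, abs_pow]
        have := h2 n x
        gcongr
      · rw [indicator_of_notMem hx, h4 n x (by simpa using hx)]; simp
    · filter_upwards with x
      exact ((h5 x).pow 2).const_mul _
  · refine Filter.Tendsto.const_mul _ ?_
    refine tendsto_integral_of_dominated_convergence
      (fun p : E × E => (closedBall (0:E) (r+1)).indicator
        (fun _ => (M + L) * (2 * (M+L) + L)) p.1 * kk q p.2) ?_ ?_ ?_ ?_
    · intro n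
      exact (FF_meas q (h1 n).continuous).aestronglyMeasurable
    · exact (ind_integrable _ _).mul_prod hk
    · intro n
      filter_upwards with p
      exact FF_bound q (h2 n) (h3 n) (h4 n) (by positivity) hL0 p.1 p.2
    · filter_upwards with p
      exact ((h5 p.1).mul ((h5 p.1).sub (h5 _))).const_mul _

end PThree

open MeasureTheory Metric Set
open scoped ENNReal NNReal

section PFour
set_option linter.unusedSectionVars false
variable {E : Type*} [NormedAddCommGroup E] [InnerProductSpace ℝ E] [FiniteDimensional ℝ E]
  [MeasurableSpace E] [BorelSpace E]

theorem ibp {F ψ : E → ℝ} {v : E} (hF : Differentiable ℝ F)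
    (hF' : Continuous (fun x => fderiv ℝ F x v)) (hψ : ContDiff ℝ 1 ψ)
    (hs : HasCompactSupport ψ) :
    ∫ x, F x * fderiv ℝ ψ x v = - ∫ x, fderiv ℝ F x v * ψ x := by
  have hψ' : Continuous (fun x => fderiv ℝ ψ x v) :=
    (hψ.continuous_fderiv (by simp)).clm_apply continuous_const
  have hs' : HasCompactSupport (fun x => fderiv ℝ ψ x v) := hs.fderiv_apply ℝ v
  apply integral_mul_fderiv_eq_neg_fderiv_mul_of_integrable
  · exact (hF'.mul hψ.continuous).integrable_of_hasCompactSupport hs.mul_left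
  · exact (hF.continuous.mul hψ').integrable_of_hasCompactSupport hs'.mul_left
  · exact (hF.continuous.mul hψ.continuous).integrable_of_hasCompactSupport hs.mul_left
  · intro x _; exact hF x
  · intro x _; exact hψ.differentiable (by simp) x

theorem u_diff_bound {u : E → ℝ} (hu : ContDiff ℝ 2 u) (hu1 : ∀ x, |u x| ≤ 1) (r : ℝ) (q : ℝ) :
    ∃ C, 0 ≤ C ∧ ∀ x z : E, ‖x‖ ≤ r → KK q z * |u x - u (x + z)| ≤ C * kk q z := by
  obtain ⟨L, hL⟩ := hu.contDiffOn.exists_lipschitzOnWith (s := closedBall (0:E) (r+1))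
    (by simp) (convex_closedBall _ _) (isCompact_closedBall _ _)
  refine ⟨2 + (L + 2), by positivity, fun x z hx => ?_⟩
  have h2 : |u x - u (x+z)| ≤ 2 := by
    have := abs_sub (u x) (u (x+z)); have := hu1 x; have := hu1 (x+z); linarith
  apply KK_mul_le q z (by norm_num) (by positivity) h2
  rcases le_or_gt ‖z‖ 1 with h | h
  · have := hL.dist_le_mul x (by simp; linarith) (x+z)
      (by simp; exact (norm_add_le x z).trans (by linarith))
    rw [Real.dist_eq, dist_eq_norm] at this
    simp only [sub_add_cancel_left, norm_neg] at this
    have := norm_nonneg z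
    linarith
  · have : (0:ℝ) ≤ L := L.2
    nlinarith

theorem lin_eq {q c : ℝ} (hk : Integrable (kk (E := E) q)) {u : E → ℝ} (hu : ContDiff ℝ 2 u)
    (hu1 : ∀ x, |u x| ≤ 1) {f f' : ℝ → ℝ}
    (hf : ∀ t ∈ Set.Icc (-1 : ℝ) 1, HasDerivAt f (f' t) t)
    (hf' : Continuous (fun x => f' (u x)))
    (heq : ∀ x, c / 2 * ∫ y : E, (2 * u x - u (x + y) - u (x - y)) / ‖y‖ ^ q = f (u x))
    (v : E) {ψ : E → ℝ} (hψ : ContDiff ℝ 1 ψ) (hs : HasCompactSupport ψ) :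
    Integrable (fun z => KK q z * ∫ x, (fderiv ℝ u x v - fderiv ℝ u (x + z) v) * ψ x) ∧
    ∫ x, f' (u x) * fderiv ℝ u x v * ψ x =
      c * ∫ z, KK q z * ∫ x, (fderiv ℝ u x v - fderiv ℝ u (x + z) v) * ψ x := by
  have hψ' : Continuous (fun x => fderiv ℝ ψ x v) :=
    (hψ.continuous_fderiv (by simp)).clm_apply continuous_const
  have hs' : HasCompactSupport (fun x => fderiv ℝ ψ x v) := hs.fderiv_apply ℝ v
  have hw : Continuous (fun x => fderiv ℝ u x v) :=
    (hu.continuous_fderiv (by simp)).clm_apply continuous_const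
  have hud : Differentiable ℝ u := hu.differentiable (by simp)
  have huc := hu.continuous
  have hKm := KK_meas (E := E) q
  -- equation
  have hint : ∀ x, Integrable (fun z => KK q z * (u x - u (x + z))) := by
    intro x
    obtain ⟨C, hC0, hC⟩ := u_diff_bound hu hu1 ‖x‖ q
    refine (hk.const_mul C).mono' ?_ ?_
    · have : Measurable u := huc.measurable
      exact Measurable.aestronglyMeasurable (by fun_prop)
    · filter_upwards with z
      rw [Real.norm_eq_abs, abs_mul, abs_of_nonneg (KK_nonneg q z)]
      exact hC x z le_rfl
  have heq' : ∀ x, f (u x) = c * ∫ z, KK q z * (u x - u (x + z)) := by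
    intro x
    rw [← heq x]
    have h1 : ∫ z, KK q z * (u x - u (x - z)) = ∫ z, KK q z * (u x - u (x + z)) := by
      rw [← integral_neg_eq_self]
      simp [KK_neg]
    have hi : Integrable (fun z => KK q z * (u x - u (x - z))) := by
      have := (hint x).comp_neg
      simpa [KK_neg, ← sub_eq_add_neg] using this
    have h2 : ∫ y : E, (2 * u x - u (x + y) - u (x - y)) / ‖y‖ ^ q
        = ∫ z, (KK q z * (u x - u (x + z)) + KK q z * (u x - u (x - z))) := by
      congr 1; ext y; unfold KK; ring
    rw [h2, integral_add (hint x) hi, h1]; ring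
  -- product integrability
  obtain ⟨r, hr⟩ : ∃ r, ∀ x, r < ‖x‖ → fderiv ℝ ψ x v = 0 := by
    obtain ⟨r, hr⟩ := hs'.isCompact.isBounded.subset_closedBall (0:E)
    refine ⟨r, fun x hx => ?_⟩
    by_contra h
    have := hr (subset_tsupport _ h)
    simp at this; linarith
  obtain ⟨C, hC0, hC⟩ := u_diff_bound hu hu1 r q
  have hH : Integrable (fun p : E × E => KK q p.2 * ((u p.1 - u (p.1 + p.2)) *
      fderiv ℝ ψ p.1 v)) (volume.prod volume) := by
    have hb : Integrable (fun x => C * |fderiv ℝ ψ x v|) :=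
      ((hψ'.integrable_of_hasCompactSupport hs').abs).const_mul C
    refine dom_integrable hk hb ?_ ?_
    · have h1 : Measurable u := huc.measurable
      have h2 := hψ'.measurable
      exact Measurable.aestronglyMeasurable (by fun_prop)
    · intro x z
      simp only
      rw [abs_mul, abs_of_nonneg (KK_nonneg q z), abs_mul, ← mul_assoc]
      rcases le_or_gt ‖x‖ r with h | h
      · have := hC x z h
        calc _ ≤ C * kk q z * |fderiv ℝ ψ x v| := by gcongr
          _ = _ := by ring
      · rw [hr x h]; simp
  have hinner : ∀ z, ∫ x, KK q z * ((u x - u (x + z)) * fderiv ℝ ψ x v)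
      = - (KK q z * ∫ x, (fderiv ℝ u x v - fderiv ℝ u (x + z) v) * ψ x) := by
    intro z
    rw [integral_const_mul]
    have hd : ∀ x, HasFDerivAt (fun x => u x - u (x + z)) (fderiv ℝ u x - fderiv ℝ u (x + z)) x := by
      intro x
      exact (hud x).hasFDerivAt.sub ((hasFDerivAt_comp_add_right z).2 (hud (x+z)).hasFDerivAt)
    have hfd : ∀ x, fderiv ℝ (fun x => u x - u (x + z)) x v = fderiv ℝ u x v - fderiv ℝ u (x+z) v := by
      intro x; rw [(hd x).fderiv]; rfl
    have := ibp (F := fun x => u x - u (x + z)) (v := v) (fun x => (hd x).differentiableAt) (by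
      simp_rw [hfd]; fun_prop) hψ hs
    rw [this]
    simp_rw [hfd]; ring
  constructor
  · have := hH.integral_prod_right
    simp only [hinner] at this
    simpa using this.neg
  · have hfd : ∀ x, HasFDerivAt (fun x => f (u x)) (f' (u x) • fderiv ℝ u x) x := by
      intro x
      exact (hf (u x) (abs_le.1 (hu1 x))).comp_hasFDerivAt x (hud x).hasFDerivAt
    have hfd' : ∀ x, fderiv ℝ (fun x => f (u x)) x v = f' (u x) * fderiv ℝ u x v := by
      intro x; rw [(hfd x).fderiv]; rfl
    have h1 := ibp (F := fun x => f (u x)) (v := v) (fun x => (hfd x).differentiableAt) (by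
      simp_rw [hfd']; exact hf'.mul hw) hψ hs
    simp_rw [hfd'] at h1
    have h2 : ∫ x, f (u x) * fderiv ℝ ψ x v =
        c * ∫ x, ∫ z, KK q z * ((u x - u (x + z)) * fderiv ℝ ψ x v) := by
      rw [← integral_const_mul]
      congr 1; ext x
      rw [heq' x, mul_assoc, ← integral_mul_const]
      congr 2; ext z; ring
    rw [integral_integral_swap hH] at h2
    simp_rw [hinner] at h2
    rw [integral_neg] at h2
    linarith

end PFour

open MeasureTheory Metric Set
open scoped ENNReal NNReal

section PFive
set_option linter.unusedSectionVars false
variable {E : Type*} [NormedAddCommGroup E] [InnerProductSpace ℝ E] [FiniteDimensional ℝ E]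
  [MeasurableSpace E] [BorelSpace E]

theorem corr_int {a : E → ℝ} (ha : Integrable a) :
    Integrable (fun p : E × E => a p.1 * a (p.1 + p.2)) (volume.prod volume) ∧
    ∫ z, ∫ x, a x * a (x + z) = (∫ x, a x)^2 := by
  have hmp := measurePreserving_prod_add (volume : Measure E) (volume : Measure E)
  have hemb : MeasurableEmbedding (fun z : E × E => (z.1, z.1 + z.2)) :=
    (MeasurableEquiv.shearAddRight E).measurableEmbedding
  have h1 : Integrable (fun p : E × E => a p.1 * a (p.1 + p.2)) (volume.prod volume) :=
    (hmp.integrable_comp_emb hemb).2 (ha.mul_prod ha)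
  refine ⟨h1, ?_⟩
  have h2 := integral_integral_swap (f := fun x z => a x * a (x + z)) h1
  rw [← h2]
  simp_rw [integral_const_mul]
  have : ∀ x : E, ∫ z, a (x + z) = ∫ z, a z := fun x => integral_add_left_eq_self a x
  simp_rw [this]
  rw [integral_mul_const, sq]

theorem main_ineq {q c : ℝ} (hc0 : 0 < c) (hk : Integrable (kk (E := E) q))
    {u : E → ℝ} (hu : ContDiff ℝ 2 u)
    (hu1 : ∀ x, |u x| ≤ 1) {f f' : ℝ → ℝ}
    (hf : ∀ t ∈ Set.Icc (-1 : ℝ) 1, HasDerivAt f (f' t) t)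
    (hf' : Continuous (fun x => f' (u x)))
    (heq : ∀ x, c / 2 * ∫ y : E, (2 * u x - u (x + y) - u (x - y)) / ‖y‖ ^ q = f (u x))
    (hst : ∀ η : E → ℝ, ContDiff ℝ (⊤ : ℕ∞) η → HasCompactSupport η →
      ∫ x, f' (u x) * (η x)^2 ≤ c / 2 * ∫ x, ∫ y, (η x - η y)^2 / ‖x - y‖ ^ q)
    (v : E) {w : E → ℝ} (hw : w = fun x => fderiv ℝ u x v)
    {φ : E → ℝ} (hφ : ContDiff ℝ (⊤ : ℕ∞) φ) (hφ0 : ∀ x, 0 ≤ φ x)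
    (hφs : ∀ x, 2 < ‖x‖ → φ x = 0) {g : E → ℝ} (hg : g = fun x => w x * φ x) :
    Integrable (fun z => KK q z * ∫ x, (|g x| * |g (x+z)| - g x * g (x+z))) ∧
    Integrable (fun z => KK q z * ∫ x, w x * w (x+z) * (φ x * (φ x - φ (x+z)))) ∧
    ∫ z, KK q z * ∫ x, (|g x| * |g (x+z)| - g x * g (x+z)) ≤
      ∫ z, KK q z * ∫ x, w x * w (x+z) * (φ x * (φ x - φ (x+z))) := by
  have hφ1 : ContDiff ℝ 1 φ := hφ.of_le (by exact_mod_cast le_top)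
  have hw1 : ContDiff ℝ 1 w := by
    rw [hw]
    exact (hu.fderiv_right (m := 1) (by norm_num)).clm_apply contDiff_const
  have hφc : HasCompactSupport φ := by
    apply HasCompactSupport.intro (isCompact_closedBall (0:E) 2)
    intro x hx
    exact hφs x (by simpa using hx)
  have hg1 : ContDiff ℝ 1 g := by rw [hg]; exact hw1.mul hφ1
  have hgc : HasCompactSupport g := by rw [hg]; exact hφc.mul_left
  have hgs : ∀ x, 2 < ‖x‖ → g x = 0 := fun x hx => by rw [hg]; simp [hφs x hx]
  have cw := hw1.continuous
  have cφ := hφ1.continuous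
  have cg := hg1.continuous
  obtain ⟨M, hM⟩ := hgc.exists_bound_of_continuous cg
  obtain ⟨L, hL⟩ := hg1.lipschitzWith_of_hasCompactSupport hgc (by simp)
  have hM0 : 0 ≤ M := (norm_nonneg _).trans (hM 0)
  have hL' : ∀ x y, |g x - g y| ≤ L * ‖x - y‖ := by
    intro x y
    have := hL.dist_le_mul x y
    rwa [Real.dist_eq, dist_eq_norm] at this
  have hF1 : Integrable (FF q g) (volume.prod volume) :=
    FF_integrable hk cg hM hL' hgs hM0 L.2
  have hM2 : ∀ x, |(|g x|)| ≤ M := fun x => by rw [abs_abs]; exact hM x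
  have hL2 : ∀ x y, |(|g x| - |g y|)| ≤ L * ‖x - y‖ := fun x y =>
    (abs_abs_sub_abs_le_abs_sub _ _).trans (hL' x y)
  have hs2 : ∀ x, 2 < ‖x‖ → |g x| = 0 := fun x hx => by rw [hgs x hx, abs_zero]
  have hF2 : Integrable (FF q (fun x => |g x|)) (volume.prod volume) :=
    FF_integrable hk cg.abs hM2 hL2 hs2 hM0 L.2
  have hstab := stab_ext hk hf' hst cg.abs hM2 hL2 hs2 hM0 L.2
  rw [integral_prod_symm _ hF2] at hstab
  have hI1 := hF1.integral_prod_right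
  have hI2 := hF2.integral_prod_right
  unfold FF at hI1 hI2 hstab
  simp only [integral_const_mul] at hI1 hI2 hstab
  obtain ⟨hI3, hlin⟩ := lin_eq hk hu hu1 hf hf' heq v (ψ := fun x => g x * φ x)
    (hg1.mul hφ1) hφc.mul_left
  have hwx : ∀ x, fderiv ℝ u x v = w x := fun x => by rw [hw]
  simp_rw [hwx] at hI3 hlin
  have hgx : ∀ x, g x = w x * φ x := fun x => by rw [hg]
  -- inner identities
  have i1 : ∀ z, Integrable (fun x => g x * (g x - g (x + z))) := fun z =>
    Continuous.integrable_of_hasCompactSupport (by fun_prop) hgc.mul_right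
  have i2 : ∀ z, Integrable (fun x => |g x| * (|g x| - |g (x + z)|)) := fun z =>
    Continuous.integrable_of_hasCompactSupport (by fun_prop) (hgc.abs).mul_right
  have i3 : ∀ z, Integrable (fun x => (w x - w (x + z)) * (g x * φ x)) := fun z =>
    Continuous.integrable_of_hasCompactSupport (by fun_prop) (hgc.mul_right).mul_left
  have e1 : ∀ z, ∫ x, (|g x| * |g (x+z)| - g x * g (x+z)) =
      (∫ x, g x * (g x - g (x + z))) - ∫ x, |g x| * (|g x| - |g (x + z)|) := by
    intro z
    rw [← integral_sub (i1 z) (i2 z)]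
    congr 1; ext x
    have := abs_mul_abs_self (g x)
    linear_combination this
  have e2 : ∀ z, ∫ x, w x * w (x+z) * (φ x * (φ x - φ (x+z))) =
      (∫ x, g x * (g x - g (x + z))) - ∫ x, (w x - w (x + z)) * (g x * φ x) := by
    intro z
    rw [← integral_sub (i1 z) (i3 z)]
    congr 1; ext x
    simp only [hgx]; ring
  simp_rw [e1, e2, mul_sub (KK q _)]
  refine ⟨hI1.sub hI2, hI1.sub hI3, ?_⟩
  rw [integral_sub hI1 hI2, integral_sub hI1 hI3]
  have e3 : ∫ x, f' (u x) * w x * (g x * φ x) = ∫ x, f' (u x) * |g x|^2 := by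
    congr 1; ext x; rw [sq_abs, hgx]; ring
  rw [← e3, hlin] at hstab
  have := le_of_mul_le_mul_left hstab hc0
  linarith

theorem main_ineq2 {q : ℝ} (hq : 0 < q) 
    {g : E → ℝ} (cg : Continuous g) (hgs : ∀ x, 2 < ‖x‖ → g x = 0) {B : ℝ}
    (hI : Integrable (fun z => KK q z * ∫ x, (|g x| * |g (x+z)| - g x * g (x+z))))
    (hB : ∫ z, KK q z * ∫ x, (|g x| * |g (x+z)| - g x * g (x+z)) ≤ B) :
    (∫ x, |g x|)^2 ≤ (∫ x, g x)^2 + 4 ^ q * B := by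
  have hgc : HasCompactSupport g := by
    apply HasCompactSupport.intro (isCompact_closedBall (0:E) 2)
    intro x hx
    exact hgs x (by simpa using hx)
  have hgi : Integrable g := cg.integrable_of_hasCompactSupport hgc
  obtain ⟨a1, a2⟩ := corr_int hgi
  obtain ⟨b1, b2⟩ := corr_int hgi.abs
  have i1 : ∀ z, Integrable (fun x => g x * g (x + z)) := fun z =>
    Continuous.integrable_of_hasCompactSupport (by fun_prop) hgc.mul_right
  have i2 : ∀ z, Integrable (fun x => |g x| * |g (x + z)|) := fun z =>
    Continuous.integrable_of_hasCompactSupport (by fun_prop) (hgc.abs).mul_right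
  have e1 : ∀ z, ∫ x, (|g x| * |g (x+z)| - g x * g (x+z)) =
      (∫ x, |g x| * |g (x+z)|) - ∫ x, g x * g (x+z) := fun z => integral_sub (i2 z) (i1 z)
  have hPSi : Integrable (fun z => ∫ x, (|g x| * |g (x+z)| - g x * g (x+z))) := by
    simp_rw [e1]
    exact b1.integral_prod_right.sub a1.integral_prod_right
  have hPS : ∫ z, ∫ x, (|g x| * |g (x+z)| - g x * g (x+z)) = (∫ x, |g x|)^2 - (∫ x, g x)^2 := by
    simp_rw [e1]
    rw [integral_sub b1.integral_prod_right a1.integral_prod_right, a2, b2]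
  have h4 : (0:ℝ) < 4 ^ q := by positivity
  have hle : ∀ z, ∫ x, (|g x| * |g (x+z)| - g x * g (x+z)) ≤
      4 ^ q * (KK q z * ∫ x, (|g x| * |g (x+z)| - g x * g (x+z))) := by
    intro z
    have hn : 0 ≤ ∫ x, (|g x| * |g (x+z)| - g x * g (x+z)) := by
      apply integral_nonneg
      intro x
      simp only [Pi.zero_apply, sub_nonneg]
      rw [← abs_mul]; exact le_abs_self _
    rcases eq_or_ne z 0 with rfl | hz
    · simp [abs_mul_abs_self]
    · rcases le_or_gt ‖z‖ 4 with h | h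
      · rw [← mul_assoc]
        refine le_mul_of_one_le_left hn ?_
        unfold KK
        have hzp : 0 < ‖z‖ := norm_pos_iff.2 hz
        rw [← div_eq_mul_inv, one_le_div (by positivity)]
        gcongr
      · have : ∀ x, |g x| * |g (x+z)| - g x * g (x+z) = 0 := by
          intro x
          rcases le_or_gt ‖x‖ 2 with hx | hx
          · have : g (x + z) = 0 := by
              apply hgs
              have := norm_sub_norm_le z (-x)
              rw [norm_neg, sub_neg_eq_add, add_comm] at this
              linarith
            simp [this]
          · simp [hgs x hx]
        simp [this]
  have := integral_mono hPSi (hI.const_mul (4^q)) hle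
  rw [hPS, integral_const_mul] at this
  nlinarith

end PFive

open MeasureTheory Metric Set
open scoped ENNReal NNReal

section PSix
set_option linter.unusedSectionVars false
variable {E : Type*} [NormedAddCommGroup E] [InnerProductSpace ℝ E] [FiniteDimensional ℝ E]
  [MeasurableSpace E] [BorelSpace E]

theorem ibp_bound {q C R : ℝ} (hC : 0 ≤ C) (hk : Integrable (kk (E := E) q)) {u : E → ℝ}
    (hu : ContDiff ℝ 2 u)
    (hu1 : ∀ x, |u x| ≤ 1) (v : E) {w : E → ℝ} (hw : w = fun x => fderiv ℝ u x v)
    {m : E → E → ℝ} (hmc : Continuous (fun p : E × E => m p.1 p.2))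
    (hmd : ∀ x, ContDiff ℝ 1 (m x)) (hsupp : ∀ x z, m x z ≠ 0 → ‖x‖ ≤ 4 ∧ ‖z‖ ≤ R)
    (hb : ∀ x z, |fderiv ℝ (m x) z v| ≤ C * kk q z) :
    |∫ z, ∫ x, w x * w (x+z) * m x z| ≤ C * (∫ z : E, kk q z) * ∫ x in closedBall (0:E) 4, |w x| := by
  have cw : Continuous w := by
    rw [hw]; exact (hu.continuous_fderiv (by simp)).clm_apply continuous_const
  have hud : Differentiable ℝ u := hu.differentiable (by simp)
  have hI : Integrable (fun p : E × E => w p.1 * w (p.1 + p.2) * m p.1 p.2)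
      (volume.prod volume) := by
    apply Continuous.integrable_of_hasCompactSupport (by fun_prop)
    apply HasCompactSupport.intro ((isCompact_closedBall (0:E) 4).prod (isCompact_closedBall (0:E) R))
    rintro ⟨x, z⟩ hx
    have : m x z = 0 := by
      by_contra h
      apply hx
      have := hsupp x z h
      simpa using this
    simp [this]
  have hsw := integral_integral_swap (f := fun x z => w x * w (x+z) * m x z) hI
  rw [← hsw]
  have hms : ∀ x, HasCompactSupport (m x) := by
    intro x
    apply HasCompactSupport.intro (isCompact_closedBall (0:E) R)
    intro z hz
    by_contra h
    exact hz (by simpa using (hsupp x z h).2)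
  have hinner : ∀ x, ∫ z, w x * w (x+z) * m x z = w x * ∫ z, w (x+z) * m x z := by
    intro x
    rw [← integral_const_mul]
    congr 1; ext z; ring
  have hbd : ∀ x, |∫ z, w (x+z) * m x z| ≤ C * ∫ z : E, kk q z := by
    intro x
    have hd : ∀ z, HasFDerivAt (fun z => u (x + z)) (fderiv ℝ u (x + z)) z := by
      intro z
      exact (hasFDerivAt_comp_add_left x).2 (hud (x+z)).hasFDerivAt
    have hfd : ∀ z, fderiv ℝ (fun z => u (x + z)) z v = w (x+z) := by
      intro z; rw [(hd z).fderiv, hw]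
    have := ibp (F := fun z => u (x + z)) (v := v) (fun x => (hd x).differentiableAt) (by
      simp_rw [hfd]; fun_prop) (hmd x) (hms x)
    simp_rw [hfd] at this
    have h2 : ∫ z, w (x+z) * m x z = - ∫ z, u (x + z) * fderiv ℝ (m x) z v := by
      rw [this]; ring
    rw [h2, abs_neg, ← integral_const_mul, ← Real.norm_eq_abs]
    apply norm_integral_le_of_norm_le (hk.const_mul C)
    filter_upwards with z
    rw [Real.norm_eq_abs, abs_mul]
    calc _ ≤ 1 * (C * kk q z) := by
          have := hu1 (x+z); have := hb x z
          gcongr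
      _ = _ := by ring
  simp_rw [hinner]
  rw [← Real.norm_eq_abs, ← integral_const_mul, ← integral_indicator measurableSet_closedBall]
  apply norm_integral_le_of_norm_le
  · rw [integrable_indicator_iff measurableSet_closedBall]
    exact (Continuous.continuousOn (by fun_prop)).integrableOn_compact (isCompact_closedBall _ _)
  · filter_upwards with x
    by_cases hx : x ∈ closedBall (0:E) 4
    · rw [indicator_of_mem hx, Real.norm_eq_abs, abs_mul, mul_comm]
      gcongr
      exact hbd x
    · rw [indicator_of_notMem hx]
      have : ∀ z, m x z = 0 := by
        intro z; by_contra h; exact hx (by simpa using (hsupp x z h).1)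
      simp [this]

/-- Regularized kernel. -/
noncomputable def Ke {E : Type*} [NormedAddCommGroup E] (q ε : ℝ) (z : E) : ℝ :=
  (‖z‖ ^ 2 + ε) ^ (-q/2)

theorem Ke_nonneg {q ε : ℝ} (hε : 0 < ε) (z : E) : 0 ≤ Ke q ε z := by
  unfold Ke; positivity

theorem Ke_neg (q ε : ℝ) (z : E) : Ke q ε (-z) = Ke q ε z := by unfold Ke; simp

theorem KK_eq (q : ℝ) (z : E) : KK q z = (‖z‖^2) ^ (-q/2) := by
  unfold KK
  rw [← Real.rpow_natCast, ← Real.rpow_mul (norm_nonneg _), ← Real.rpow_neg (norm_nonneg _)]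
  congr 1; push_cast; ring

theorem Ke_le {q ε : ℝ} (hq : 0 < q) (hε : 0 < ε) {z : E} (hz : z ≠ 0) :
    Ke q ε z ≤ KK q z := by
  rw [KK_eq]; unfold Ke
  have hzp : 0 < ‖z‖ := norm_pos_iff.2 hz
  apply Real.rpow_le_rpow_of_nonpos (by positivity) (by linarith) (by linarith)

theorem Ke_contDiff {q ε : ℝ} (hε : 0 < ε) : ContDiff ℝ 1 (Ke (E := E) q ε) := by
  unfold Ke
  apply ContDiff.rpow_const_of_ne
  · exact (contDiff_norm_sq ℝ).add contDiff_const
  · intro x; positivity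

theorem Ke_deriv {q ε : ℝ} (hq : 0 < q) (hε : 0 < ε) {z : E} (hz : z ≠ 0) {v : E} (hv : ‖v‖ ≤ 1) :
    ‖z‖ * |fderiv ℝ (Ke q ε) z v| ≤ q * KK q z := by
  have hpos : 0 < ‖z‖^2 + ε := by positivity
  have h1 : HasFDerivAt (fun z : E => ‖z‖^2 + ε) (2 • innerSL ℝ z) z :=
    (hasStrictFDerivAt_norm_sq z).hasFDerivAt.add_const ε
  have h2 := h1.rpow_const (p := -q/2) (Or.inl hpos.ne')
  have h3 : fderiv ℝ (Ke q ε) z v = (-q/2) * (‖z‖^2+ε) ^ (-q/2 - 1) * (2 * inner ℝ z v) := by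
    have : fderiv ℝ (Ke q ε) z = _ := h2.fderiv
    rw [this]; simp
  rw [h3]
  have h4 : |inner ℝ z v| ≤ ‖z‖ := (abs_real_inner_le_norm z v).trans
    (mul_le_of_le_one_right (norm_nonneg _) hv)
  have h5 : (‖z‖^2+ε) ^ (-q/2 - 1) * (‖z‖^2+ε) = Ke q ε z := by
    unfold Ke
    rw [Real.rpow_sub_one hpos.ne']; field_simp
  have h6 : 0 ≤ (‖z‖^2+ε) ^ (-q/2 - 1) := by positivity
  have h7 := Ke_le hq hε hz
  rw [abs_mul, abs_mul, abs_of_nonneg h6, abs_mul, abs_of_neg (by linarith : -q/2 < 0)]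
  simp only [abs_two]
  calc ‖z‖ * (-(-q / 2) * (‖z‖ ^ 2 + ε) ^ (-q / 2 - 1) * (2 * |inner ℝ z v|))
      = q * ((‖z‖ ^ 2 + ε) ^ (-q / 2 - 1) * (‖z‖ * |inner ℝ z v|)) := by ring
    _ ≤ q * ((‖z‖ ^ 2 + ε) ^ (-q / 2 - 1) * (‖z‖^2 + ε)) := by
        gcongr
        nlinarith [norm_nonneg z]
    _ ≤ q * KK q z := by rw [h5]; gcongr

/-- Cutoff data. -/
structure Cut (φ : E → ℝ) (L : ℝ) : Prop where
  smooth : ContDiff ℝ (⊤ : ℕ∞) φ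
  nonneg : ∀ x, 0 ≤ φ x
  le_one : ∀ x, φ x ≤ 1
  even : ∀ x, φ (-x) = φ x
  one : ∀ x, ‖x‖ ≤ 1 → φ x = 1
  zero : ∀ x, 2 ≤ ‖x‖ → φ x = 0
  lip : ∀ x y, |φ x - φ y| ≤ L * ‖x - y‖
  dbd : ∀ x v, ‖v‖ ≤ 1 → |fderiv ℝ φ x v| ≤ L
  done : ∀ x, ‖x‖ < 1 → fderiv ℝ φ x = 0
  dzero : ∀ x, 2 < ‖x‖ → fderiv ℝ φ x = 0
  Lnn : 0 ≤ L

theorem exists_cut : ∃ (φ : E → ℝ) (L : ℝ), Cut φ L := by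
  let b : ContDiffBump (0:E) := ⟨1, 2, by norm_num, by norm_num⟩
  have hs : ContDiff ℝ (⊤ : ℕ∞) b := b.contDiff
  have hs1 : ContDiff ℝ 1 b := b.contDiff
  obtain ⟨L, hL⟩ := hs1.lipschitzWith_of_hasCompactSupport b.hasCompactSupport (by simp)
  have h1 : ∀ x : E, ‖x‖ ≤ 1 → b x = 1 := fun x hx =>
    b.one_of_mem_closedBall (by simpa using hx)
  have h0 : ∀ x : E, 2 ≤ ‖x‖ → b x = 0 := fun x hx =>
    b.zero_of_le_dist (by simpa using hx)
  refine ⟨b, L, hs, b.nonneg', fun x => b.le_one, b.neg, h1, h0, ?_, ?_, ?_, ?_, L.2⟩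
  · intro x y
    have := hL.dist_le_mul x y
    rwa [Real.dist_eq, dist_eq_norm] at this
  · intro x v hv
    have h := norm_fderiv_le_of_lipschitz ℝ hL (x₀ := x)
    calc |fderiv ℝ b x v| ≤ ‖fderiv ℝ b x‖ * ‖v‖ := (fderiv ℝ b x).le_opNorm v
      _ ≤ L * 1 := by gcongr
      _ = L := mul_one _
  · intro x hx
    have : (b : E → ℝ) =ᶠ[nhds x] fun _ => 1 := by
      filter_upwards [isOpen_lt continuous_norm continuous_const |>.mem_nhds hx] with y hy
      exact h1 y (le_of_lt hy)
    rw [this.fderiv_eq]; simp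
  · intro x hx
    have : (b : E → ℝ) =ᶠ[nhds x] fun _ => 0 := by
      filter_upwards [isOpen_lt continuous_const continuous_norm |>.mem_nhds hx] with y hy
      exact h0 y (le_of_lt hy)
    rw [this.fderiv_eq]; simp

theorem near_bound {q ε L : ℝ} (hq : 0 < q) (hε : 0 < ε) {φ : E → ℝ} (h : Cut φ L) {v : E}
    (hv : ‖v‖ ≤ 1) (x z : E) :
    |fderiv ℝ (fun z => Ke q ε z * φ z * (φ x - φ (x+z))^2) z v| ≤
      2 * (q * L^2 + 2 * L^3 + 2 * L^2) * kk q z := by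
  have hφd : Differentiable ℝ φ := h.smooth.differentiable (by simp)
  have hL := h.Lnn
  have h1 : HasFDerivAt (Ke q ε) (fderiv ℝ (Ke q ε) z) z :=
    ((Ke_contDiff hε).differentiable (by simp) z).hasFDerivAt
  have h2 : HasFDerivAt φ (fderiv ℝ φ z) z := (hφd z).hasFDerivAt
  have h3 : HasFDerivAt (fun z => φ x - φ (x + z)) (-fderiv ℝ φ (x+z)) z := by
    have := ((hasFDerivAt_comp_add_left x).2 (hφd (x+z)).hasFDerivAt).const_sub (φ x)
    exact this
  have h4 := (h1.mul h2).mul (h3.pow 2)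
  have e : fderiv ℝ (fun z => Ke q ε z * φ z * (φ x - φ (x+z))^2) z v =
      fderiv ℝ (Ke q ε) z v * φ z * (φ x - φ (x+z))^2
      + Ke q ε z * fderiv ℝ φ z v * (φ x - φ (x+z))^2
      - Ke q ε z * φ z * (2 * (φ x - φ (x+z)) * fderiv ℝ φ (x+z) v) := by
    have : fderiv ℝ (fun z => Ke q ε z * φ z * (φ x - φ (x+z))^2) z = _ := h4.fderiv
    rw [this]; simp; ring
  rw [e]
  have hkk := kk_nonneg q z
  rcases eq_or_ne z 0 with rfl | hz
  · simp; positivity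
  rcases lt_or_ge 2 ‖z‖ with hz2 | hz2
  · rw [h.zero z hz2.le, h.dzero z hz2]; simp; positivity
  have hzp : 0 < ‖z‖ := norm_pos_iff.2 hz
  have hD : |φ x - φ (x+z)| ≤ L * ‖z‖ := by simpa using h.lip x (x+z)
  have hK := KK_nonneg q z
  have hKe := Ke_le hq hε hz
  have hKe0 := Ke_nonneg (q := q) hε z
  have hKd := Ke_deriv hq hε hz hv
  have d1 := h.dbd z v hv
  have d2 := h.dbd (x+z) v hv
  have hφz : |φ z| ≤ 1 := by rw [abs_of_nonneg (h.nonneg z)]; exact h.le_one z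
  have t1 : |fderiv ℝ (Ke q ε) z v * φ z * (φ x - φ (x+z))^2| ≤ q * L^2 * (KK q z * ‖z‖) := by
    rw [abs_mul, abs_mul, abs_pow]
    calc _ ≤ |fderiv ℝ (Ke q ε) z v| * 1 * (L * ‖z‖)^2 := by gcongr
      _ = (‖z‖ * |fderiv ℝ (Ke q ε) z v|) * (L^2 * ‖z‖) := by ring
      _ ≤ (q * KK q z) * (L^2 * ‖z‖) := by gcongr
      _ = _ := by ring
  have t2 : |Ke q ε z * fderiv ℝ φ z v * (φ x - φ (x+z))^2| ≤ 2 * L^3 * (KK q z * ‖z‖) := by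
    rw [abs_mul, abs_mul, abs_pow, abs_of_nonneg hKe0]
    calc _ ≤ KK q z * L * (L * ‖z‖)^2 := by gcongr
      _ = L^3 * (KK q z * ‖z‖) * ‖z‖ := by ring
      _ ≤ L^3 * (KK q z * ‖z‖) * 2 := by gcongr
      _ = _ := by ring
  have t3 : |Ke q ε z * φ z * (2 * (φ x - φ (x+z)) * fderiv ℝ φ (x+z) v)| ≤
      2 * L^2 * (KK q z * ‖z‖) := by
    rw [abs_mul, abs_mul, abs_mul, abs_mul, abs_of_nonneg hKe0, abs_two]
    calc _ ≤ KK q z * 1 * (2 * (L * ‖z‖) * L) := by gcongr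
      _ = _ := by ring
  have hmin : KK q z * ‖z‖ ≤ 2 * kk q z := by
    unfold kk
    change _ ≤ 2 * (min 1 ‖z‖ * KK q z)
    have : ‖z‖ ≤ 2 * min 1 ‖z‖ := by
      rcases min_choice 1 ‖z‖ with h | h <;> rw [h] <;> linarith
    nlinarith
  calc _ ≤ q * L^2 * (KK q z * ‖z‖) + 2 * L^3 * (KK q z * ‖z‖) + 2 * L^2 * (KK q z * ‖z‖) := by
        refine (abs_sub _ _).trans (add_le_add ((abs_add_le _ _).trans (add_le_add t1 t2)) t3)
    _ = (q * L^2 + 2 * L^3 + 2 * L^2) * (KK q z * ‖z‖) := by ring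
    _ ≤ (q * L^2 + 2 * L^3 + 2 * L^2) * (2 * kk q z) := by gcongr
    _ = _ := by ring

theorem far_bound {q ε L N : ℝ} (hq : 0 < q) (hε : 0 < ε) (hN : 1 ≤ N) {φ : E → ℝ} (h : Cut φ L)
    {v : E} (hv : ‖v‖ ≤ 1) (x z : E) :
    |fderiv ℝ (fun z => Ke q ε z * (φ (N⁻¹ • z) - φ z) * (φ x * (φ x - φ (x+z)))) z v| ≤
      (q + 3 * L) * kk q z := by
  have hφd : Differentiable ℝ φ := h.smooth.differentiable (by simp)
  have hL := h.Lnn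
  have hN0 : 0 < N := by linarith
  have hNi : N⁻¹ ≤ 1 := inv_le_one_of_one_le₀ hN
  have hNi0 : 0 < N⁻¹ := by positivity
  have h1 : HasFDerivAt (Ke q ε) (fderiv ℝ (Ke q ε) z) z :=
    ((Ke_contDiff hε).differentiable (by simp) z).hasFDerivAt
  have h2 : HasFDerivAt φ (fderiv ℝ φ z) z := (hφd z).hasFDerivAt
  have h2' : HasFDerivAt (fun z => φ (N⁻¹ • z)) (N⁻¹ • fderiv ℝ φ (N⁻¹ • z)) z := by
    have this : HasFDerivAt (fun z => φ (N⁻¹ • z))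
        ((fderiv ℝ φ (N⁻¹ • z)).comp (N⁻¹ • ContinuousLinearMap.id ℝ E)) z :=
      HasFDerivAt.comp (g := φ) (f := fun z : E => N⁻¹ • z) z
        (hφd (N⁻¹ • z)).hasFDerivAt ((hasFDerivAt_id z).const_smul N⁻¹)
    have e0 : N⁻¹ • fderiv ℝ φ (N⁻¹ • z) =
        (fderiv ℝ φ (N⁻¹ • z)).comp (N⁻¹ • ContinuousLinearMap.id ℝ E) := by
      ext y; simp
    rw [e0]; exact this
  have h3 : HasFDerivAt (fun z => φ x * (φ x - φ (x + z))) (φ x • (-fderiv ℝ φ (x+z))) z := by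
    have := ((hasFDerivAt_comp_add_left x).2 (hφd (x+z)).hasFDerivAt).const_sub (φ x)
    exact this.const_mul (φ x)
  have h4 := (h1.mul (h2'.sub h2)).mul h3
  have e : fderiv ℝ (fun z => Ke q ε z * (φ (N⁻¹ • z) - φ z) * (φ x * (φ x - φ (x+z)))) z v =
      fderiv ℝ (Ke q ε) z v * (φ (N⁻¹ • z) - φ z) * (φ x * (φ x - φ (x+z)))
      + Ke q ε z * (N⁻¹ * fderiv ℝ φ (N⁻¹ • z) v - fderiv ℝ φ z v) * (φ x * (φ x - φ (x+z)))
      - Ke q ε z * (φ (N⁻¹ • z) - φ z) * (φ x * fderiv ℝ φ (x+z) v) := by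
    have : fderiv ℝ (fun z => Ke q ε z * (φ (N⁻¹ • z) - φ z) * (φ x * (φ x - φ (x+z)))) z = _ :=
      h4.fderiv
    rw [this]; simp; ring
  rw [e]
  have hkk := kk_nonneg q z
  have hnz : ‖N⁻¹ • z‖ ≤ ‖z‖ := by
    rw [norm_smul, Real.norm_of_nonneg hNi0.le]
    exact mul_le_of_le_one_left (norm_nonneg _) hNi
  rcases lt_or_ge ‖z‖ 1 with hz1 | hz1
  · rw [h.one z hz1.le, h.done z hz1, h.one _ (hnz.trans hz1.le), h.done _ (hnz.trans_lt hz1)]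
    simp; positivity
  have hz : z ≠ 0 := by rw [← norm_pos_iff]; linarith
  have hkK : kk q z = KK q z := by unfold kk KK; rw [min_eq_left hz1, one_mul]
  rw [hkK]
  have hK := KK_nonneg q z
  have hKe := Ke_le hq hε hz
  have hKe0 := Ke_nonneg (q := q) hε z
  have hKd := Ke_deriv hq hε hz hv
  have hKd' : |fderiv ℝ (Ke q ε) z v| ≤ q * KK q z := by
    refine le_trans ?_ hKd
    exact le_mul_of_one_le_left (abs_nonneg _) hz1
  have d1 := h.dbd z v hv
  have d2 := h.dbd (x+z) v hv
  have d3 := h.dbd (N⁻¹ • z) v hv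
  have hdiff : ∀ a b, |φ a - φ b| ≤ 1 := by
    intro a b
    have := h.nonneg a; have := h.nonneg b; have := h.le_one a; have := h.le_one b
    rw [abs_le]; constructor <;> linarith
  have hφx : |φ x| ≤ 1 := by rw [abs_of_nonneg (h.nonneg x)]; exact h.le_one x
  have d4 : |N⁻¹ * fderiv ℝ φ (N⁻¹ • z) v - fderiv ℝ φ z v| ≤ 2 * L := by
    refine (abs_sub _ _).trans ?_
    rw [abs_mul, abs_of_pos hNi0]
    have : N⁻¹ * |fderiv ℝ φ (N⁻¹ • z) v| ≤ 1 * L := by gcongr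
    linarith
  have t1 : |fderiv ℝ (Ke q ε) z v * (φ (N⁻¹ • z) - φ z) * (φ x * (φ x - φ (x+z)))| ≤
      q * KK q z := by
    rw [abs_mul, abs_mul, abs_mul]
    calc _ ≤ q * KK q z * 1 * (1 * 1) := by gcongr <;> apply hdiff
      _ = _ := by ring
  have t2 : |Ke q ε z * (N⁻¹ * fderiv ℝ φ (N⁻¹ • z) v - fderiv ℝ φ z v) *
      (φ x * (φ x - φ (x+z)))| ≤ 2 * L * KK q z := by
    rw [abs_mul, abs_mul, abs_mul, abs_of_nonneg hKe0]
    calc _ ≤ KK q z * (2 * L) * (1 * 1) := by gcongr; apply hdiff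
      _ = _ := by ring
  have t3 : |Ke q ε z * (φ (N⁻¹ • z) - φ z) * (φ x * fderiv ℝ φ (x+z) v)| ≤ L * KK q z := by
    rw [abs_mul, abs_mul, abs_mul, abs_of_nonneg hKe0]
    calc _ ≤ KK q z * 1 * (1 * L) := by gcongr; apply hdiff
      _ = _ := by ring
  calc _ ≤ q * KK q z + 2 * L * KK q z + L * KK q z := by
        refine (abs_sub _ _).trans (add_le_add ((abs_add_le _ _).trans (add_le_add t1 t2)) t3)
    _ = _ := by ring

end PSix

open MeasureTheory Metric Set
open scoped ENNReal NNReal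

section PSeven
set_option linter.unusedSectionVars false
variable {E : Type*} [NormedAddCommGroup E] [InnerProductSpace ℝ E] [FiniteDimensional ℝ E]
  [MeasurableSpace E] [BorelSpace E]

theorem pint {R : ℝ} {w : E → ℝ} (cw : Continuous w)
    {m : E → E → ℝ} (hmc : Continuous (fun p : E × E => m p.1 p.2))
    (hsupp : ∀ x z, m x z ≠ 0 → ‖x‖ ≤ 4 ∧ ‖z‖ ≤ R) :
    Integrable (fun z => ∫ x, w x * w (x+z) * m x z) := by
  have hI : Integrable (fun p : E × E => w p.1 * w (p.1 + p.2) * m p.1 p.2)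
      (volume.prod volume) := by
    apply Continuous.integrable_of_hasCompactSupport (by fun_prop)
    apply HasCompactSupport.intro ((isCompact_closedBall (0:E) 4).prod (isCompact_closedBall (0:E) R))
    rintro ⟨x, z⟩ hx
    have : m x z = 0 := by
      by_contra h
      apply hx
      have := hsupp x z h
      simpa using this
    simp [this]
  exact hI.integral_prod_right

theorem Cut.le_two {φ : E → ℝ} {L : ℝ} (h : Cut φ L) {x : E} (hx : φ x ≠ 0) : ‖x‖ ≤ 2 := by
  by_contra hh
  exact hx (h.zero x (by linarith))

theorem Cut.hcs {φ : E → ℝ} {L : ℝ} (h : Cut φ L) : HasCompactSupport φ := by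
  apply HasCompactSupport.intro (isCompact_closedBall (0:E) 2)
  intro x hx
  exact h.zero x (le_of_lt (by simpa using hx))

theorem D_symm {φ w : E → ℝ} {L : ℝ} (h : Cut φ L) (cw : Continuous w) (z : E) :
    (∫ x, w x * w (x+z) * (φ x * (φ x - φ (x+z)))) +
    (∫ x, w x * w (x+(-z)) * (φ x * (φ x - φ (x+(-z))))) =
    ∫ x, w x * w (x+z) * (φ x - φ (x+z))^2 := by
  have cφ : Continuous φ := h.smooth.continuous
  have e : (∫ x, w x * w (x+(-z)) * (φ x * (φ x - φ (x+(-z))))) =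
      ∫ x, w x * w (x+z) * (φ (x+z) * (φ (x+z) - φ x)) := by
    rw [← integral_add_right_eq_self _ z]
    congr 1; ext x
    simp only [add_neg_cancel_right]
    ring
  rw [e, ← integral_add]
  · congr 1; ext x; ring
  · apply Continuous.integrable_of_hasCompactSupport (by fun_prop)
    apply HasCompactSupport.intro (isCompact_closedBall (0:E) 2)
    intro x hx
    rw [h.zero x (le_of_lt (by simpa using hx))]; simp
  · apply Continuous.integrable_of_hasCompactSupport (by fun_prop)
    apply HasCompactSupport.intro (isCompact_closedBall (-z:E) 2)
    intro x hx
    rw [h.zero (x+z) (le_of_lt (by simpa [dist_eq_norm] using hx))]; simp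

theorem Dn_bound {q ε L N : ℝ} (hq : 0 < q) (hε : 0 < ε) (hN : 1 ≤ N) {φ : E → ℝ} (h : Cut φ L)
    (hk : Integrable (kk (E := E) q)) {u : E → ℝ} (hu : ContDiff ℝ 2 u)
    (hu1 : ∀ x, |u x| ≤ 1) {v : E} (hv : ‖v‖ ≤ 1) {w : E → ℝ} (hw : w = fun x => fderiv ℝ u x v) :
    |∫ z, Ke q ε z * φ (N⁻¹ • z) * ∫ x, w x * w (x+z) * (φ x * (φ x - φ (x+z)))| ≤
      ((q * L^2 + 2 * L^3 + 2 * L^2) + (q + 3 * L)) * (∫ z : E, kk q z) *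
        ∫ x in closedBall (0:E) 4, |w x| := by
  have cw : Continuous w := by
    rw [hw]; exact (hu.continuous_fderiv (by simp)).clm_apply continuous_const
  have cφ : Continuous φ := h.smooth.continuous
  have dφ : ContDiff ℝ 1 φ := h.smooth.of_le (by exact_mod_cast le_top)
  have dK := Ke_contDiff (E := E) (q := q) hε
  have cK : Continuous (Ke (E := E) q ε) := dK.continuous
  have hL := h.Lnn
  have hN0 : 0 < N := by linarith
  set D : E → ℝ := fun z => ∫ x, w x * w (x+z) * (φ x * (φ x - φ (x+z))) with hD
  set W := ∫ x in closedBall (0:E) 4, |w x|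
  set k0 := ∫ z : E, kk q z
  -- near
  have hPi : Integrable (fun z => Ke q ε z * φ z * D z) := by
    have := pint (R := 2) cw (m := fun x z => Ke q ε z * φ z * (φ x * (φ x - φ (x+z)))) (by fun_prop)
      (by
        intro x z hne
        have h1 : φ x ≠ 0 := by intro h0; simp [h0] at hne
        have h2 : φ z ≠ 0 := by intro h0; simp [h0] at hne
        exact ⟨(h.le_two h1).trans (by norm_num), h.le_two h2⟩)
    refine this.congr (Filter.Eventually.of_forall fun z => ?_)
    simp only [hD]
    rw [← integral_const_mul]; congr 1; ext x; ring
  have hFi : Integrable (fun z => Ke q ε z * (φ (N⁻¹ • z) - φ z) * D z) ∧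
      |∫ z, Ke q ε z * (φ (N⁻¹ • z) - φ z) * D z| ≤ (q + 3 * L) * k0 * W := by
    have e : (fun z => Ke q ε z * (φ (N⁻¹ • z) - φ z) * D z) = fun z =>
        ∫ x, w x * w (x+z) * (Ke q ε z * (φ (N⁻¹ • z) - φ z) * (φ x * (φ x - φ (x+z)))) := by
      ext z
      simp only [hD]
      rw [← integral_const_mul]; congr 1; ext x; ring
    have hsup : ∀ x z, Ke q ε z * (φ (N⁻¹ • z) - φ z) * (φ x * (φ x - φ (x+z))) ≠ 0 →
        ‖x‖ ≤ 4 ∧ ‖z‖ ≤ 2 * N := by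
      intro x z hne
      have h1 : φ x ≠ 0 := by intro h0; simp [h0] at hne
      refine ⟨(h.le_two h1).trans (by norm_num), ?_⟩
      by_contra hh
      push Not at hh
      have a1 : φ z = 0 := h.zero z (by nlinarith)
      have a2 : φ (N⁻¹ • z) = 0 := by
        apply h.zero
        rw [norm_smul, Real.norm_of_nonneg (by positivity), inv_mul_eq_div, le_div_iff₀ hN0]
        exact hh.le
      simp [a1, a2] at hne
    rw [e]
    refine ⟨pint cw (m := fun x z => Ke q ε z * (φ (N⁻¹ • z) - φ z) * (φ x * (φ x - φ (x+z))))
      (by fun_prop) hsup, ?_⟩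
    exact ibp_bound (by positivity) hk hu hu1 v hw
      (m := fun x z => Ke q ε z * (φ (N⁻¹ • z) - φ z) * (φ x * (φ x - φ (x+z)))) (by fun_prop)
      (by intro x; fun_prop) hsup (fun x z => far_bound hq hε hN h hv x z)
  have hNb : |∫ z, Ke q ε z * φ z * D z| ≤ (q * L^2 + 2 * L^3 + 2 * L^2) * k0 * W := by
    have e1 : ∫ z, Ke q ε (-z) * φ (-z) * D (-z) = ∫ z, Ke q ε z * φ z * D z :=
      integral_neg_eq_self (fun z => Ke q ε z * φ z * D z) volume
    have e2 : 2 * ∫ z, Ke q ε z * φ z * D z =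
        ∫ z, ∫ x, w x * w (x+z) * (Ke q ε z * φ z * (φ x - φ (x+z))^2) := by
      calc _ = (∫ z, Ke q ε z * φ z * D z) + ∫ z, Ke q ε (-z) * φ (-z) * D (-z) := by
            rw [e1]; ring
        _ = ∫ z, (Ke q ε z * φ z * D z + Ke q ε (-z) * φ (-z) * D (-z)) := by
            rw [integral_add hPi hPi.comp_neg]
        _ = _ := by
            congr 1; ext z
            rw [Ke_neg, h.even, ← mul_add]
            simp only [hD]
            rw [D_symm h cw z, ← integral_const_mul]
            congr 1; ext x; ring
    have e3 := ibp_bound (R := 2) (C := 2 * (q * L^2 + 2 * L^3 + 2 * L^2)) (by positivity) hk hu hu1 v hw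
      (m := fun x z => Ke q ε z * φ z * (φ x - φ (x+z))^2) (by fun_prop)
      (by intro x; fun_prop) (by
        intro x z hne
        have h2 : φ z ≠ 0 := by intro h0; simp [h0] at hne
        have hz := h.le_two h2
        refine ⟨?_, hz⟩
        by_contra hh
        push Not at hh
        have a1 : φ x = 0 := h.zero x (by linarith)
        have a2 : φ (x + z) = 0 := by
          apply h.zero
          have := norm_sub_le (x+z) z
          rw [add_sub_cancel_right] at this
          linarith
        simp [a1, a2] at hne) (fun x z => near_bound hq hε h hv x z)
    rw [← e2, abs_mul, abs_two] at e3
    change _ ≤ _ * k0 * W at e3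
    linarith
  have split : ∫ z, Ke q ε z * φ (N⁻¹ • z) * D z =
      (∫ z, Ke q ε z * φ z * D z) + ∫ z, Ke q ε z * (φ (N⁻¹ • z) - φ z) * D z := by
    rw [← integral_add hPi hFi.1]
    congr 1; ext z; ring
  rw [split]
  refine (abs_add_le _ _).trans ((add_le_add hNb hFi.2).trans (le_of_eq ?_))
  ring

theorem D_bound {q L : ℝ} (hq : 0 < q) {φ : E → ℝ} (h : Cut φ L)
    (hk : Integrable (kk (E := E) q)) {u : E → ℝ} (hu : ContDiff ℝ 2 u)
    (hu1 : ∀ x, |u x| ≤ 1) {v : E} (hv : ‖v‖ ≤ 1) {w : E → ℝ} (hw : w = fun x => fderiv ℝ u x v)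
    (hI : Integrable (fun z => KK q z * ∫ x, w x * w (x+z) * (φ x * (φ x - φ (x+z))))) :
    ∫ z, KK q z * ∫ x, w x * w (x+z) * (φ x * (φ x - φ (x+z))) ≤
      ((q * L^2 + 2 * L^3 + 2 * L^2) + (q + 3 * L)) * (∫ z : E, kk q z) *
        ∫ x in closedBall (0:E) 4, |w x| := by
  have cw : Continuous w := by
    rw [hw]; exact (hu.continuous_fderiv (by simp)).clm_apply continuous_const
  have cφ : Continuous φ := h.smooth.continuous
  have cK : ∀ ε : ℝ, 0 < ε → Continuous (Ke (E := E) q ε) := fun ε hε => (Ke_contDiff hε).continuous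
  set D : E → ℝ := fun z => ∫ x, w x * w (x+z) * (φ x * (φ x - φ (x+z))) with hD
  have hD0 : D 0 = 0 := by simp [hD]
  have hDm : AEStronglyMeasurable D := by
    have : StronglyMeasurable (fun p : E × E => w p.2 * w (p.2+p.1) * (φ p.2 * (φ p.2 - φ (p.2+p.1)))) :=
      Continuous.stronglyMeasurable (by fun_prop)
    exact (this.integral_prod_right (ν := volume)).aestronglyMeasurable
  have hnpos : ∀ n : ℕ, (0:ℝ) < 1 / ((n:ℝ)+1) := fun n => by positivity
  have ht : Filter.Tendsto (fun n : ℕ => ∫ z, Ke q (1/((n:ℝ)+1)) z * φ (((n:ℝ)+1)⁻¹ • z) * D z)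
      Filter.atTop (nhds (∫ z, KK q z * D z)) := by
    apply tendsto_integral_of_dominated_convergence (fun z => |KK q z * D z|)
    · intro n
      have := cK _ (hnpos n)
      exact (Continuous.aestronglyMeasurable (by fun_prop)).mul hDm
    · exact hI.abs
    · intro n
      filter_upwards with z
      rcases eq_or_ne z 0 with rfl | hz
      · simp [hD0]
      rw [Real.norm_eq_abs, abs_mul, abs_mul, abs_mul, abs_of_nonneg (Ke_nonneg (hnpos n) z),
        abs_of_nonneg (KK_nonneg q z), abs_of_nonneg (h.nonneg _)]
      gcongr
      calc _ ≤ KK q z * 1 := by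
            have := Ke_le hq (hnpos n) hz
            have := KK_nonneg q z
            have := h.le_one (((n:ℝ)+1)⁻¹ • z)
            have := h.nonneg (((n:ℝ)+1)⁻¹ • z)
            gcongr
        _ = _ := mul_one _
    · filter_upwards with z
      rcases eq_or_ne z 0 with rfl | hz
      · simp [hD0]
      apply Filter.Tendsto.mul_const
      have t0 : Filter.Tendsto (fun n : ℕ => 1/((n:ℝ)+1)) Filter.atTop (nhds 0) :=
        tendsto_one_div_add_atTop_nhds_zero_nat
      have t1 : Filter.Tendsto (fun n : ℕ => Ke q (1/((n:ℝ)+1)) z) Filter.atTop (nhds (KK q z)) := by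
        rw [KK_eq]; unfold Ke
        have hzp : 0 < ‖z‖ := norm_pos_iff.2 hz
        have t2 : Filter.Tendsto (fun n : ℕ => ‖z‖^2 + 1/((n:ℝ)+1)) Filter.atTop (nhds (‖z‖^2)) := by
          simpa using t0.const_add (‖z‖^2)
        exact t2.rpow_const (Or.inl (by positivity))
      have t3 : Filter.Tendsto (fun n : ℕ => φ (((n:ℝ)+1)⁻¹ • z)) Filter.atTop (nhds 1) := by
        have : Filter.Tendsto (fun n : ℕ => ((n:ℝ)+1)⁻¹ • z) Filter.atTop (nhds ((0:ℝ) • z)) := by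
          simp only [one_div] at t0
          exact t0.smul_const z
        have h1 : φ ((0:ℝ) • z) = 1 := h.one _ (by simp)
        have h2 := (cφ.tendsto _).comp this
        rw [h1] at h2
        exact h2
      simpa using t1.mul t3
  refine le_of_tendsto ht (Filter.Eventually.of_forall fun n => ?_)
  refine (le_abs_self _).trans ?_
  exact Dn_bound hq (hnpos n) (by linarith [n.cast_nonneg (α := ℝ)]) h hk hu hu1 hv hw

theorem g_bound {L : ℝ} {φ : E → ℝ} (h : Cut φ L) {u : E → ℝ} (hu : ContDiff ℝ 2 u)
    (hu1 : ∀ x, |u x| ≤ 1) {v : E} (hv : ‖v‖ ≤ 1) {w : E → ℝ} (hw : w = fun x => fderiv ℝ u x v) :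
    |∫ x, w x * φ x| ≤ L * volume.real (closedBall (0:E) 2) := by
  have cw : Continuous w := by
    rw [hw]; exact (hu.continuous_fderiv (by simp)).clm_apply continuous_const
  have dφ : ContDiff ℝ 1 φ := h.smooth.of_le (by exact_mod_cast le_top)
  have := ibp (F := u) (v := v) (hu.differentiable (by simp)) (by rw [hw] at cw; exact cw) dφ h.hcs
  have e : ∫ x, w x * φ x = - ∫ x, u x * fderiv ℝ φ x v := by rw [this, hw]; simp
  rw [e, abs_neg, ← Real.norm_eq_abs]
  have e2 : L * volume.real (closedBall (0:E) 2) =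
      ∫ x, (closedBall (0:E) 2).indicator (fun _ => L) x := by
    rw [integral_indicator measurableSet_closedBall, setIntegral_const, smul_eq_mul, mul_comm]
  rw [e2]
  apply norm_integral_le_of_norm_le
  · rw [integrable_indicator_iff measurableSet_closedBall]
    exact continuous_const.continuousOn.integrableOn_compact (isCompact_closedBall _ _)
  · filter_upwards with x
    by_cases hx : x ∈ closedBall (0:E) 2
    · rw [indicator_of_mem hx, Real.norm_eq_abs, abs_mul]
      calc _ ≤ 1 * L := by
            have := hu1 x; have := h.dbd x v hv
            gcongr
        _ = L := one_mul _
    · rw [indicator_of_notMem hx, h.dzero x (by simpa using hx)]; simp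

theorem key {q : ℝ} (hq : 0 < q) (hk : Integrable (kk (E := E) q)) :
    ∃ C : ℝ, 0 < C ∧ ∀ (c : ℝ) (u : E → ℝ) (f f' : ℝ → ℝ), 0 < c → ContDiff ℝ 2 u →
    (∀ x, |u x| ≤ 1) →
    (∀ t ∈ Set.Icc (-1 : ℝ) 1, HasDerivAt f (f' t) t) →
    Continuous (fun x => f' (u x)) →
    (∀ x, c / 2 * ∫ y : E, (2 * u x - u (x + y) - u (x - y)) / ‖y‖ ^ q = f (u x)) →
    (∀ η : E → ℝ, ContDiff ℝ (⊤ : ℕ∞) η → HasCompactSupport η →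
      ∫ x, f' (u x) * (η x)^2 ≤ c / 2 * ∫ x, ∫ y, (η x - η y)^2 / ‖x - y‖ ^ q) →
    ∀ v : E, ‖v‖ ≤ 1 →
      (∫ x in ball (0:E) 1, |fderiv ℝ u x v|)^2 ≤ C * (1 + ∫ x in ball (0:E) 8, |fderiv ℝ u x v|) := by
  obtain ⟨φ, L, h⟩ := exists_cut (E := E)
  have hL := h.Lnn
  set A := (L * volume.real (closedBall (0:E) 2))^2
  set B := 4^q * (((q * L^2 + 2 * L^3 + 2 * L^2) + (q + 3 * L)) * (∫ z : E, kk q z))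
  have hA : 0 ≤ A := by positivity
  have hB : 0 ≤ B := by
    have : 0 ≤ ∫ z : E, kk q z := integral_nonneg (fun z => kk_nonneg q z)
    positivity
  refine ⟨A + B + 1, by positivity, ?_⟩
  intro c u f f' hc hu hu1 hf hf' heq hst v hv
  set w : E → ℝ := fun x => fderiv ℝ u x v with hw
  have cw : Continuous w := (hu.continuous_fderiv (by simp)).clm_apply continuous_const
  have cφ : Continuous φ := h.smooth.continuous
  obtain ⟨h1, h2, h3⟩ := main_ineq hc hk hu hu1 hf hf' heq hst v hw h.smooth h.nonneg
    (fun x hx => h.zero x hx.le) (g := fun x => w x * φ x) rfl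
  have h4 := D_bound hq h hk hu hu1 hv hw h2
  have h5 := main_ineq2 hq (g := fun x => w x * φ x) (by fun_prop)
    (fun x hx => by simp [h.zero x hx.le]) h1 (h3.trans h4)
  have h6 : (∫ x, w x * φ x)^2 ≤ A := by
    rw [← sq_abs]
    exact pow_le_pow_left₀ (abs_nonneg _) (g_bound h hu hu1 hv hw) 2
  have h7 : ∫ x in ball (0:E) 1, |w x| ≤ ∫ x, |w x * φ x| := by
    have hi : Integrable (fun x => |w x * φ x|) :=
      (Continuous.integrable_of_hasCompactSupport (by fun_prop) h.hcs.mul_left).abs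
    calc ∫ x in ball (0:E) 1, |w x| = ∫ x in ball (0:E) 1, |w x * φ x| := by
          apply setIntegral_congr_fun measurableSet_ball
          intro x hx
          have : φ x = 1 := h.one x (le_of_lt (by simpa using hx))
          simp [this]
      _ ≤ _ := setIntegral_le_integral hi (Filter.Eventually.of_forall fun x => abs_nonneg _)
  have h8 : ∫ x in closedBall (0:E) 4, |w x| ≤ ∫ x in ball (0:E) 8, |w x| := by
    apply setIntegral_mono_set
    · exact ((Continuous.continuousOn (by fun_prop)).integrableOn_compact
        (isCompact_closedBall (0:E) 8)).mono_set ball_subset_closedBall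
    · exact Filter.Eventually.of_forall fun x => abs_nonneg _
    · exact (closedBall_subset_ball (by norm_num)).eventuallyLE
  have h9 : 0 ≤ ∫ x in ball (0:E) 1, |w x| := integral_nonneg fun x => abs_nonneg _
  have h10 : 0 ≤ ∫ x in ball (0:E) 8, |w x| := integral_nonneg fun x => abs_nonneg _
  calc _ ≤ (∫ x, |w x * φ x|)^2 := by gcongr
    _ ≤ A + B * ∫ x in closedBall (0:E) 4, |w x| := by
        refine h5.trans (add_le_add h6 (le_of_eq ?_))
        ring
    _ ≤ A + B * ∫ x in ball (0:E) 8, |w x| := by gcongr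
    _ ≤ _ := by nlinarith
end PSeven

open MeasureTheory Metric Set
open scoped ENNReal NNReal

section PEight
set_option linter.unusedSectionVars false
variable {E : Type*} [NormedAddCommGroup E] [InnerProductSpace ℝ E] [FiniteDimensional ℝ E]
  [MeasurableSpace E] [BorelSpace E]

theorem mul_div_mul_comm_of_ne_helper {a b c : ℝ} (ha : a ≠ 0) : a * (b / (a * c)) = b / c := by
  rw [← mul_div_assoc, mul_div_mul_left _ _ ha]

theorem cov (F : E → ℝ) (x₀ : E) {r : ℝ} (hr : 0 < r) :
    ∫ y, F (x₀ + r • y) = (r ^ Module.finrank ℝ E)⁻¹ * ∫ x, F x := by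
  have h1 := Measure.integral_comp_smul_of_nonneg (volume : Measure E) (fun z => F (x₀ + z)) r
    (hR := hr.le)
  rw [h1, smul_eq_mul, integral_add_left_eq_self]

theorem cov_ball (F : E → ℝ) (x₀ : E) {r a : ℝ} (hr : 0 < r) :
    ∫ y in ball (0:E) a, F (x₀ + r • y) =
      (r ^ Module.finrank ℝ E)⁻¹ * ∫ x in ball x₀ (a * r), F x := by
  rw [← integral_indicator measurableSet_ball, ← integral_indicator measurableSet_ball,
    ← cov _ x₀ hr]
  congr 1; ext y
  have : y ∈ ball (0:E) a ↔ x₀ + r • y ∈ ball x₀ (a * r) := by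
    rw [mem_ball_zero_iff, mem_ball_iff_norm, add_sub_cancel_left, norm_smul,
      Real.norm_of_nonneg hr.le, mul_comm a r, mul_lt_mul_iff_right₀ hr]
  by_cases hy : y ∈ ball (0:E) a
  · rw [indicator_of_mem hy, indicator_of_mem (this.1 hy)]
  · rw [indicator_of_notMem hy, indicator_of_notMem (fun h => hy (this.2 h))]

theorem key_scaled {q : ℝ} (hq : 0 < q) (hk : Integrable (kk (E := E) q)) :
    ∃ C : ℝ, 0 < C ∧ ∀ (c : ℝ) (u : E → ℝ) (f f' : ℝ → ℝ), 0 < c → ContDiff ℝ 2 u →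
    (∀ x, |u x| ≤ 1) →
    (∀ t ∈ Set.Icc (-1 : ℝ) 1, HasDerivAt f (f' t) t) →
    Continuous (fun x => f' (u x)) →
    (∀ x, c / 2 * ∫ y : E, (2 * u x - u (x + y) - u (x - y)) / ‖y‖ ^ q = f (u x)) →
    (∀ η : E → ℝ, ContDiff ℝ (⊤ : ℕ∞) η → HasCompactSupport η →
      ∫ x, f' (u x) * (η x)^2 ≤ c / 2 * ∫ x, ∫ y, (η x - η y)^2 / ‖x - y‖ ^ q) →
    ∀ v : E, ‖v‖ ≤ 1 → ∀ (x₀ : E) (r : ℝ), 0 < r →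
      (r * (r ^ Module.finrank ℝ E)⁻¹ * ∫ x in ball x₀ r, |fderiv ℝ u x v|)^2 ≤
      C * (1 + r * (r ^ Module.finrank ℝ E)⁻¹ * ∫ x in ball x₀ (8*r), |fderiv ℝ u x v|) := by
  obtain ⟨C, hC, key⟩ := key hq hk
  refine ⟨C, hC, ?_⟩
  intro c u f f' hc hu hu1 hf hf' heq hst v hv x₀ r hr
  have hrq : 0 < r ^ q := Real.rpow_pos_of_pos hr q
  have hrd : 0 < (r ^ Module.finrank ℝ E)⁻¹ := by positivity
  have hnorm : ∀ y : E, ‖r • y‖ ^ q = r ^ q * ‖y‖ ^ q := by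
    intro y
    rw [norm_smul, Real.norm_of_nonneg hr.le, Real.mul_rpow hr.le (norm_nonneg _)]
  set ρ := r ^ q * (r ^ Module.finrank ℝ E)⁻¹ with hρ
  have hρ0 : 0 < ρ := by positivity
  have haff : ContDiff ℝ 2 (fun y : E => x₀ + r • y) := by fun_prop
  have K := key c (fun y => u (x₀ + r • y)) (fun t => ρ * f t) (fun t => ρ * f' t) hc
    (hu.comp haff) (fun x => hu1 _) (fun t ht => (hf t ht).const_mul ρ)
    (by
      have : Continuous (fun y : E => f' (u (x₀ + r • y))) :=
        hf'.comp (by fun_prop : Continuous (fun y : E => x₀ + r • y))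
      exact this.const_mul ρ)
    (by
      intro x
      have e := cov (fun z => (2 * u (x₀ + r • x) - u (x₀ + r • x + z) - u (x₀ + r • x - z)) / ‖z‖ ^ q)
        0 hr
      have e2 : ∫ y : E, (2 * u (x₀ + r • x) - u (x₀ + r • (x + y)) - u (x₀ + r • (x - y))) / ‖y‖ ^ q
          = r ^ q * ∫ y : E, (2 * u (x₀ + r • x) - u (x₀ + r • x + (0 + r • y))
            - u (x₀ + r • x - (0 + r • y))) / ‖0 + r • y‖ ^ q := by
        rw [← integral_const_mul]
        congr 1; ext y
        rw [zero_add, hnorm, smul_add, smul_sub, ← add_assoc, ← add_sub_assoc]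
        rw [mul_div_mul_comm_of_ne_helper hrq.ne']
      rw [e2, e, ← heq]
      ring)
    (by
      intro η hη hηs
      have hsm : ContDiff ℝ (⊤ : ℕ∞) (fun X : E => r⁻¹ • (X - x₀)) := by fun_prop
      set ζ : E → ℝ := fun X => η (r⁻¹ • (X - x₀)) with hζ
      have hζη : ∀ y, ζ (x₀ + r • y) = η y := by
        intro y; simp only [hζ]
        rw [add_sub_cancel_left, smul_smul, inv_mul_cancel₀ hr.ne', one_smul]
      have hζs : HasCompactSupport ζ := by
        obtain ⟨R, hR⟩ := hηs.isCompact.isBounded.subset_closedBall (0:E)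
        apply HasCompactSupport.intro (isCompact_closedBall x₀ (r * R))
        intro X hX
        by_contra hne
        have := hR (subset_tsupport _ (Function.mem_support.2 hne))
        rw [mem_closedBall_zero_iff, norm_smul, Real.norm_of_nonneg (by positivity),
          inv_mul_eq_div, div_le_iff₀ hr] at this
        apply hX
        rw [mem_closedBall_iff_norm]; linarith
      have h1 := hst ζ (hη.comp hsm) hζs
      have e1 := cov (fun X => f' (u X) * (ζ X)^2) x₀ hr
      have e2 := cov (fun X => ∫ Y, (ζ X - ζ Y)^2 / ‖X - Y‖^q) x₀ hr
      have e3 : ∀ x, ∫ y, (η x - η y)^2 / ‖x - y‖ ^ q =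
          ρ * ∫ Y, (ζ (x₀ + r • x) - ζ Y)^2 / ‖x₀ + r • x - Y‖^q := by
        intro x
        have e := cov (fun Y => (ζ (x₀ + r • x) - ζ Y)^2 / ‖x₀ + r • x - Y‖^q) x₀ hr
        rw [hρ, mul_assoc, ← e, ← integral_const_mul]
        congr 1; ext y
        rw [hζη, hζη, add_sub_add_left_eq_sub, ← smul_sub, hnorm,
          mul_div_mul_comm_of_ne_helper hrq.ne']
      simp only [hζη] at e1
      simp_rw [e3]
      rw [integral_const_mul, e2]
      simp_rw [mul_assoc]
      rw [integral_const_mul, e1]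
      calc _ = ρ * (r ^ Module.finrank ℝ E)⁻¹ * (∫ X, f' (u X) * (ζ X)^2) := by ring
        _ ≤ ρ * (r ^ Module.finrank ℝ E)⁻¹ * (c / 2 * ∫ x, ∫ y, (ζ x - ζ y)^2 / ‖x - y‖ ^ q) := by
            gcongr
        _ = _ := by ring) v hv
  have hfd : ∀ y, |fderiv ℝ (fun y => u (x₀ + r • y)) y v| = r * |fderiv ℝ u (x₀ + r • y) v| := by
    intro y
    have hd1 : HasFDerivAt (fun y : E => x₀ + r • y) (r • ContinuousLinearMap.id ℝ E) y :=
      ((hasFDerivAt_id y).const_smul r).const_add x₀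
    have hd2 := HasFDerivAt.comp (g := u) y
      (hu.differentiable (by simp) (x₀ + r • y)).hasFDerivAt hd1
    have : fderiv ℝ (fun y => u (x₀ + r • y)) y = _ := hd2.fderiv
    rw [this]
    simp [abs_mul, abs_of_pos hr]
  simp_rw [hfd, integral_const_mul] at K
  rw [cov_ball (fun x => |fderiv ℝ u x v|) x₀ hr, cov_ball (fun x => |fderiv ℝ u x v|) x₀ hr,
    one_mul] at K
  simpa only [mul_assoc] using K
end PEight

open MeasureTheory Metric Set
open scoped ENNReal NNReal

section PNine
set_option linter.unusedSectionVars false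
variable {E : Type*} [NormedAddCommGroup E] [InnerProductSpace ℝ E] [FiniteDimensional ℝ E]
  [MeasurableSpace E] [BorelSpace E]

/-- Scale-invariant average. -/
noncomputable def Fav (h : E → ℝ) (x : E) (r : ℝ) : ℝ :=
  r * (r ^ Module.finrank ℝ E)⁻¹ * ∫ y in ball x r, h y

theorem int_ball {h : E → ℝ} (hc : Continuous h) (x : E) (r : ℝ) : IntegrableOn h (ball x r) :=
  (hc.continuousOn.integrableOn_compact (isCompact_closedBall x r)).mono_set ball_subset_closedBall

theorem Fav_cover (T : Finset E) (hT : closedBall (0:E) 1 ⊆ ⋃ t ∈ T, ball t (1/64))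
    {h : E → ℝ} (hc : Continuous h) (h0 : ∀ x, 0 ≤ h x) (x : E) {r : ℝ} (hr : 0 < r) :
    Fav h x r ≤ 64 * ∑ t ∈ T, Fav h (x + r • t) (r/64) := by
  have h1 : ∫ y in ball x r, h y ≤ ∑ t ∈ T, ∫ y in ball (x + r • t) (r/64), h y := by
    rw [← integral_indicator measurableSet_ball]
    have : ∀ t, ∫ y in ball (x + r • t) (r/64), h y =
        ∫ y, (ball (x + r • t) (r/64)).indicator h y := fun t =>
      (integral_indicator measurableSet_ball).symm
    simp_rw [this]
    rw [← integral_finsetSum]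
    · apply integral_mono
      · exact (integrable_indicator_iff measurableSet_ball).2 (int_ball hc _ _)
      · exact integrable_finsetSum _ fun t _ =>
          (integrable_indicator_iff measurableSet_ball).2 (int_ball hc _ _)
      · intro y
        have hnn : ∀ t ∈ T, 0 ≤ (ball (x + r • t) (r/64)).indicator h y := fun t _ =>
          indicator_nonneg (fun y _ => h0 y) y
        by_cases hy : y ∈ ball x r
        · simp only [indicator_of_mem hy]
          have hy' : r⁻¹ • (y - x) ∈ closedBall (0:E) 1 := by
            rw [mem_closedBall_zero_iff, norm_smul, Real.norm_of_nonneg (by positivity),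
              inv_mul_eq_div, div_le_one hr]
            exact le_of_lt (by simpa [dist_eq_norm] using hy)
          have := hT hy'
          simp only [mem_iUnion, exists_prop] at this
          obtain ⟨t, ht, hyt⟩ := this
          have hm : y ∈ ball (x + r • t) (r/64) := by
            rw [mem_ball_iff_norm] at hyt ⊢
            have e : y - (x + r • t) = r • (r⁻¹ • (y - x) - t) := by
              rw [smul_sub, smul_smul, mul_inv_cancel₀ hr.ne', one_smul]; abel
            rw [e, norm_smul, Real.norm_of_nonneg hr.le]
            calc _ < r * (1/64) := by gcongr
              _ = _ := by ring
          calc h y = (ball (x + r • t) (r/64)).indicator h y := by rw [indicator_of_mem hm]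
            _ ≤ _ := Finset.single_le_sum hnn ht
        · simp only [indicator_of_notMem hy]
          exact Finset.sum_nonneg hnn
    · exact fun t _ => (integrable_indicator_iff measurableSet_ball).2 (int_ball hc _ _)
  have h2 : 0 ≤ ∑ t ∈ T, ∫ y in ball (x + r • t) (r/64), h y :=
    Finset.sum_nonneg fun t _ => integral_nonneg h0
  unfold Fav
  rw [← Finset.mul_sum]
  calc _ ≤ r * (r ^ Module.finrank ℝ E)⁻¹ * ∑ t ∈ T, ∫ y in ball (x + r • t) (r/64), h y := by
        gcongr
    _ ≤ r * ((r/64) ^ Module.finrank ℝ E)⁻¹ * ∑ t ∈ T, ∫ y in ball (x + r • t) (r/64), h y := by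
        gcongr
        linarith
    _ = _ := by ring

theorem absorb {C : ℝ} (hC : 0 < C) : ∃ C' : ℝ, 0 < C' ∧ ∀ h : E → ℝ, Continuous h →
    (∀ x, 0 ≤ h x) →
    (∀ (x : E) (r : ℝ), 0 < r → (Fav h x r)^2 ≤
      C * (1 + r * (r ^ Module.finrank ℝ E)⁻¹ * ∫ y in ball x (8*r), h y)) →
    ∀ (x₀ : E) (R : ℝ), 0 < R → Fav h x₀ R ≤ C' := by
  obtain ⟨T, hT1, hTf, hT2⟩ := finite_cover_balls_of_compact (isCompact_closedBall (0:E) 1)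
    (by norm_num : (0:ℝ) < 1/64)
  lift T to Finset E using hTf
  set n := Module.finrank ℝ E with hn
  set P := (64 * (T.card : ℝ))^2 * C * 8^n with hP
  have hP0 : 0 ≤ P := by positivity
  refine ⟨P + 1, by positivity, ?_⟩
  intro h hc h0 hH x₀ R hR
  have Fnn : ∀ x r, 0 < r → 0 ≤ Fav h x r := fun x r hr => by
    have : 0 ≤ ∫ y in ball x r, h y := integral_nonneg h0
    unfold Fav; positivity
  set S : Set ℝ := {a | ∃ x r, 0 < r ∧ ‖x - x₀‖ + 8 * r ≤ 8 * R ∧ a = Fav h x r} with hS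
  have hbdd : BddAbove S := by
    obtain ⟨M, hM⟩ := (isCompact_closedBall x₀ (8*R)).bddAbove_image hc.continuousOn
    refine ⟨R * (M * volume.real (ball (0:E) 1)), ?_⟩
    rintro a ⟨x, r, hr, hxr, rfl⟩
    have e := cov_ball h x (a := 1) hr
    rw [one_mul] at e
    unfold Fav
    rw [mul_assoc, ← e]
    have hM0 : 0 ≤ M := (h0 x₀).trans (hM ⟨x₀, by simp; positivity, rfl⟩)
    have hle : ∫ y in ball (0:E) 1, h (x + r • y) ≤ M * volume.real (ball (0:E) 1) := by
      calc _ ≤ ∫ y in ball (0:E) 1, M := by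
            apply setIntegral_mono_on _ _ measurableSet_ball
            · intro y hy
              apply hM
              refine ⟨_, ?_, rfl⟩
              rw [mem_closedBall_iff_norm]
              have hy : ‖y‖ < 1 := by simpa using hy
              calc ‖x + r • y - x₀‖ = ‖(x - x₀) + r • y‖ := by congr 1; abel
                _ ≤ ‖x - x₀‖ + r * ‖y‖ := by
                  refine (norm_add_le _ _).trans ?_
                  rw [norm_smul, Real.norm_of_nonneg hr.le]
                _ ≤ ‖x - x₀‖ + r * 1 := by gcongr
                _ ≤ 8 * R := by linarith
            · exact int_ball (by fun_prop) _ _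
            · exact int_ball (by fun_prop) _ _
        _ = _ := by rw [setIntegral_const, smul_eq_mul, mul_comm]
    have hrR : r ≤ R := by linarith [norm_nonneg (x - x₀)]
    have hi0 : 0 ≤ ∫ y in ball (0:E) 1, h (x + r • y) := integral_nonneg fun y => h0 _
    gcongr
  have hmem : ∀ x r, 0 < r → ‖x - x₀‖ + 8 * r ≤ 8 * R → Fav h x r ≤ sSup S :=
    fun x r hr hx => le_csSup hbdd ⟨x, r, hr, hx, rfl⟩
  set Q := sSup S with hQ
  have hself : Fav h x₀ R ≤ Q := hmem x₀ R hR (by simp)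
  have hQ0 : 0 ≤ Q := (Fnn x₀ R hR).trans hself
  have hstep : Q ≤ 64 * (T.card * Real.sqrt (C * (1 + 8^n * Q))) := by
    have hne : S.Nonempty := ⟨Fav h x₀ R, x₀, R, hR, by simp, rfl⟩
    apply csSup_le hne
    rintro a ⟨x, r, hr, hxr, rfl⟩
    refine (Fav_cover T (by simpa using hT2) hc h0 x hr).trans ?_
    gcongr
    rw [← nsmul_eq_mul]
    apply Finset.sum_le_card_nsmul
    intro t ht
    apply Real.le_sqrt_of_sq_le
    refine (hH _ _ (by positivity)).trans ?_
    have ht1 : ‖t‖ ≤ 1 := by simpa using hT1 ht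
    have hadm : Fav h (x + r • t) (r/8) ≤ Q := by
      apply hmem _ _ (by positivity)
      have : ‖x + r • t - x₀‖ ≤ ‖x - x₀‖ + r := by
        calc ‖x + r • t - x₀‖ = ‖(x - x₀) + r • t‖ := by congr 1; abel
          _ ≤ ‖x - x₀‖ + r * ‖t‖ := by
            refine (norm_add_le _ _).trans ?_
            rw [norm_smul, Real.norm_of_nonneg hr.le]
          _ ≤ ‖x - x₀‖ + r * 1 := by gcongr
          _ = _ := by ring
      linarith
    have e : r/64 * ((r/64)^n)⁻¹ * ∫ y in ball (x + r • t) (8 * (r/64)), h y =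
        8^n * (1/8) * Fav h (x + r • t) (r/8) := by
      unfold Fav
      rw [show 8 * (r/64) = r/8 by ring, show r/64 = (r/8)/8 by ring, div_pow (r/8) 8, inv_div, ← hn]
      ring
    rw [e, mul_assoc]
    have hF0 := Fnn (x + r • t) (r/8) (by positivity)
    have h8 : 1/8 * Fav h (x + r • t) (r/8) ≤ Q := by linarith
    gcongr
  have hsq : Q^2 ≤ P * (1 + Q) := by
    calc Q^2 ≤ (64 * (T.card * Real.sqrt (C * (1 + 8^n * Q))))^2 := by gcongr
      _ = (64 * (T.card : ℝ))^2 * C * (1 + 8^n * Q) := by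
          rw [mul_pow, mul_pow, Real.sq_sqrt (by positivity)]; ring
      _ ≤ (64 * (T.card : ℝ))^2 * C * (8^n * (1 + Q)) := by
          have : (1:ℝ) ≤ 8^n := one_le_pow₀ (by norm_num)
          gcongr
          linarith
      _ = _ := by rw [hP]; ring
  refine hself.trans ?_
  by_contra hh
  push Not at hh
  nlinarith
end PNine

theorem fracC_pos (d : ℕ) (s : ℝ) (hs0 : 0 < s) (hs1 : s < 1/2) : 0 < fracC d s := by
  unfold fracC
  have h1 : 0 < Real.Gamma ((d:ℝ)/2 + s) := Real.Gamma_pos_of_pos (by positivity)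
  have h2 : Real.Gamma (-s) ≠ 0 := by
    apply Real.Gamma_ne_zero
    intro m hm
    have : s = m := by linarith
    rcases m with _ | m
    · simp at this; linarith
    · push_cast at this
      linarith [m.cast_nonneg (α := ℝ)]
  have h3 : 0 < |Real.Gamma (-s)| := abs_pos.2 h2
  have := Real.pi_pos
  positivity

theorem stmt11 (d : ℕ) (hd : 1 ≤ d) (s : ℝ) (hs0 : 0 < s) (hs1 : s < 1/2) :
    ∃ C₁ : ℝ, 0 < C₁ ∧ ∀ α : ℝ, 1 - 2*s < α → ∀ f f' : ℝ → ℝ, IsC1Alpha f f' α →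
      ∀ u : EuclideanSpace ℝ (Fin d) → ℝ, IsStableSolution d s f f' u →
      ∀ x₀ : EuclideanSpace ℝ (Fin d), ∀ R : ℝ, 1 ≤ R →
        (∫ x in ball x₀ R, ‖fderiv ℝ u x‖) ≤ C₁ * R ^ ((d : ℝ) - 1) := by
  have hk := kk_integrable d hd s hs0 hs1
  have hq : 0 < (d:ℝ) + 2 * s := by positivity
  obtain ⟨C, hC, key⟩ := key_scaled hq hk
  obtain ⟨C', hC', hab⟩ := absorb (E := EuclideanSpace ℝ (Fin d)) hC
  have hd0 : (0:ℝ) < d := by exact_mod_cast hd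
  refine ⟨d * C', by positivity, ?_⟩
  intro α hα f f' hf u hu x₀ R hR
  obtain ⟨hf1, Cα, hCα, hh⟩ := hf
  obtain ⟨hu2, hu1, heq, hst⟩ := hu
  have hα0 : 0 < α := by linarith
  have hR0 : 0 < R := by linarith
  have hmem : ∀ x, u x ∈ Set.Icc (-1:ℝ) 1 := fun x => abs_le.1 (hu1 x)
  have hcont : Continuous (fun x => f' (u x)) := by
    rw [continuous_iff_continuousAt]
    intro x
    rw [ContinuousAt, tendsto_iff_dist_tendsto_zero]
    have hlim : Filter.Tendsto (fun y => Cα * |u y - u x| ^ α) (nhds x) (nhds 0) := by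
      have hc : Continuous (fun y => Cα * |u y - u x| ^ α) := by
        have := hu2.continuous
        exact continuous_const.mul
          (Continuous.rpow_const (by fun_prop) (fun _ => Or.inr hα0.le))
      have := hc.tendsto x
      simpa [Real.zero_rpow hα0.ne'] using this
    apply squeeze_zero (fun _ => dist_nonneg) _ hlim
    intro y
    rw [Real.dist_eq]
    exact hh _ (hmem y) _ (hmem x)
  have hcd : Continuous (fderiv ℝ u) := hu2.continuous_fderiv (by simp)
  have hv : ∀ i : Fin d, ∫ x in ball x₀ R, |fderiv ℝ u x (EuclideanSpace.single i 1)| ≤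
      C' * R ^ ((d:ℝ) - 1) := by
    intro i
    have h1 := hab (fun x => |fderiv ℝ u x (EuclideanSpace.single i 1)|)
      (hcd.clm_apply continuous_const).abs (fun x => abs_nonneg _)
      (fun x r hr => key (fracC d s) u f f' (fracC_pos d s hs0 hs1) hu2 hu1 hf1 hcont heq hst
        (EuclideanSpace.single i 1) (by simp) x r hr) x₀ R hR0
    unfold Fav at h1
    rw [finrank_euclideanSpace_fin] at h1
    rw [Real.rpow_sub_one hR0.ne', Real.rpow_natCast]
    have e : R * (R^d)⁻¹ = (R^d / R)⁻¹ := by rw [inv_div]; rfl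
    rw [e, inv_mul_le_iff₀ (by positivity)] at h1
    linarith
  have hpt : ∀ x, ‖fderiv ℝ u x‖ ≤ ∑ i : Fin d, |fderiv ℝ u x (EuclideanSpace.single i 1)| := by
    intro x
    apply ContinuousLinearMap.opNorm_le_bound _ (Finset.sum_nonneg fun i _ => abs_nonneg _)
    intro y
    have hy : y = ∑ i : Fin d, y i • EuclideanSpace.single i (1:ℝ) := by
      have := (EuclideanSpace.basisFun (Fin d) ℝ).sum_repr y
      simpa using this.symm
    have e : fderiv ℝ u x y = ∑ i : Fin d, y i * fderiv ℝ u x (EuclideanSpace.single i (1:ℝ)) := by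
      conv_lhs => rw [hy]
      simp
    rw [e, Finset.sum_mul, Real.norm_eq_abs]
    refine (Finset.abs_sum_le_sum_abs _ _).trans (Finset.sum_le_sum fun i _ => ?_)
    rw [abs_mul, mul_comm]
    gcongr
    exact PiLp.norm_apply_le y i
  have hii : ∀ i : Fin d, IntegrableOn
      (fun x => |fderiv ℝ u x (EuclideanSpace.single i 1)|) (ball x₀ R) := fun i =>
    int_ball (hcd.clm_apply continuous_const).abs _ _
  calc _ ≤ ∫ x in ball x₀ R, ∑ i : Fin d, |fderiv ℝ u x (EuclideanSpace.single i 1)| := by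
        apply integral_mono (int_ball hcd.norm _ _) (integrable_finsetSum _ fun i _ => hii i)
        exact hpt
    _ = ∑ i : Fin d, ∫ x in ball x₀ R, |fderiv ℝ u x (EuclideanSpace.single i 1)| :=
        integral_finsetSum _ fun i _ => hii i
    _ ≤ ∑ i : Fin d, C' * R ^ ((d:ℝ) - 1) := Finset.sum_le_sum fun i _ => hv i
    _ = _ := by simp; ring
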